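/- Let G₁ and G₂ be finitely presented groups and put n₁ = rk G₁/G₁', n₂ = rk G₂/G₂'. Assume there exist finitely generated subgroups K₁, K₂ with G₁' ≤ K₁ ≤ G₁ and G₂' ≤ K₂ ≤ G₂ of co-ranks m and k respectively (rk G₁/K₁ = m and rk G₂/K₂ = k). Then there exists a finitely presented normal fibre product in G₁ × G₂ of co-rank n = min{m + k, n₁, n₂}. -/

import Mathlib

/-- A group is finitely presented if it is the quotient of a finitely generated free group
by the normal closure of finitely many relators. -/
def FinitelyPresentedGroup (G : Type*) [Group G] : Prop :=
  ∃ (n : ℕ) (f : FreeGroup (Fin n) →* G) (S : Finset (FreeGroup (Fin n))),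
    Function.Surjective f ∧ f.ker = Subgroup.normalClosure (S : Set (FreeGroup (Fin n)))

/-- The torsion-free rank of the abelianization of `G`, i.e. `rk G/G'`. -/
noncomputable def rkAb (G : Type*) [Group G] : ℕ :=
  Module.finrank ℤ (Additive (Abelianization G))

/-- The torsion-free rank of the quotient `G ⧸ K` (for `K` a normal subgroup). -/
noncomputable def rkQuot {G : Type*} [Group G] (K : Subgroup G) (hK : K.Normal) : ℕ :=
  letI := hK
  rkAb (G ⧸ K)

namespace FibreProd

section Words
variable {Γ J : Type*} [Group Γ]

/-- evaluation of a word -/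
def ev (e : J → Γ) (L : List J) : Γ := (L.map e).prod

/-- weight of a word -/
def wgt (wt : J → ℕ) (L : List J) : ℕ := (L.map wt).sum

/-- subgroup generated by conjugates of elements of `Z` by words of weight at most `n`. -/
def Sb (e : J → Γ) (wt : J → ℕ) (Z : Set Γ) (n : ℕ) : Subgroup Γ :=
  Subgroup.closure {g | ∃ L : List J, wgt wt L ≤ n ∧ ∃ z ∈ Z, g = ev e L * z * (ev e L)⁻¹}

variable {e : J → Γ} {wt : J → ℕ}

@[simp] lemma ev_nil : ev e [] = 1 := rfl
@[simp] lemma ev_cons (i : J) (L : List J) : ev e (i :: L) = e i * ev e L := by simp [ev]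
@[simp] lemma ev_append (L L' : List J) : ev e (L ++ L') = ev e L * ev e L' := by simp [ev]
@[simp] lemma wgt_nil : wgt wt [] = 0 := rfl
@[simp] lemma wgt_cons (i : J) (L : List J) : wgt wt (i :: L) = wt i + wgt wt L := by simp [wgt]
@[simp] lemma wgt_append (L L' : List J) : wgt wt (L ++ L') = wgt wt L + wgt wt L' := by
  simp [wgt]

lemma wgt_perm {L L' : List J} (h : L.Perm L') : wgt wt L = wgt wt L' :=
  (h.map wt).sum_eq

lemma Sb_mono {Z : Set Γ} {a b : ℕ} (h : a ≤ b) : Sb e wt Z a ≤ Sb e wt Z b := by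
  apply Subgroup.closure_mono
  rintro g ⟨L, hL, hz⟩
  exact ⟨L, hL.trans h, hz⟩

lemma mem_Sb {Z : Set Γ} {z : Γ} (hz : z ∈ Z) {L : List J} {n : ℕ} (hL : wgt wt L ≤ n) :
    ev e L * z * (ev e L)⁻¹ ∈ Sb e wt Z n :=
  Subgroup.subset_closure ⟨L, hL, z, hz, rfl⟩

lemma mem_Sb_self {Z : Set Γ} {z : Γ} (hz : z ∈ Z) {n : ℕ} : z ∈ Sb e wt Z n := by
  simpa using mem_Sb (e := e) (wt := wt) (L := []) hz (Nat.zero_le n)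

lemma conj_mem_Sb {Z : Set Γ} {z : Γ} {a n : ℕ} (p : List J) (hz : z ∈ Sb e wt Z a)
    (h : wgt wt p + a ≤ n) : ev e p * z * (ev e p)⁻¹ ∈ Sb e wt Z n := by
  have : Sb e wt Z a ≤ (Sb e wt Z n).comap (MulAut.conj (ev e p)).toMonoidHom := by
    rw [Sb, Subgroup.closure_le]
    rintro g ⟨L, hL, y, hy, rfl⟩
    have := mem_Sb (e := e) (wt := wt) (L := p ++ L) (n := n) hy (by simp; omega)
    simpa [mul_assoc] using this
  simpa using this hz

/-- two subgroups given by closures commute -/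
lemma commute_closure {S T : Set Γ} (h : ∀ s ∈ S, ∀ t ∈ T, Commute s t) {a b : Γ}
    (ha : a ∈ Subgroup.closure S) (hb : b ∈ Subgroup.closure T) : Commute a b := by
  have h1 : ∀ s ∈ S, Commute s b := by
    intro s hs
    have : Subgroup.closure T ≤ Subgroup.centralizer {s} := by
      rw [Subgroup.closure_le]
      intro t ht
      simp only [SetLike.mem_coe, Subgroup.mem_centralizer_iff, Set.mem_singleton_iff, forall_eq]
      exact h s hs t ht
    have := this hb
    simp only [Subgroup.mem_centralizer_iff, Set.mem_singleton_iff, forall_eq] at this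
    exact this
  have : Subgroup.closure S ≤ Subgroup.centralizer {b} := by
    rw [Subgroup.closure_le]
    intro t ht
    simp only [SetLike.mem_coe, Subgroup.mem_centralizer_iff, Set.mem_singleton_iff, forall_eq]
    exact (h1 t ht).symm
  have := this ha
  simp only [Subgroup.mem_centralizer_iff, Set.mem_singleton_iff, forall_eq] at this
  exact Commute.symm this

lemma commute_conj_iff {a b c : Γ} : Commute (c * a * c⁻¹) (c * b * c⁻¹) ↔ Commute a b :=
  Commute.conj_iff c

variable (e wt) in
/-- commuting up to radius K -/
def Com (X Y : Set Γ) (K : ℕ) : Prop :=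
  ∀ x ∈ X, ∀ y ∈ Y, ∀ L : List J, wgt wt L ≤ K → Commute x (ev e L * y * (ev e L)⁻¹)

/-- reversed inverse word -/
def rv (inv : J → J) (L : List J) : List J := (L.map inv).reverse

lemma ev_rv {inv : J → J} (hinv : ∀ j, e (inv j) = (e j)⁻¹) (L : List J) :
    ev e (rv inv L) = (ev e L)⁻¹ := by
  induction L with
  | nil => simp [rv]
  | cons a L ih =>
    have : rv inv (a :: L) = rv inv L ++ [inv a] := by simp [rv]
    rw [this, ev_append, ih]; simp [hinv]

lemma wgt_rv {inv : J → J} (hinv : ∀ j, wt (inv j) = wt j) (L : List J) :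
    wgt wt (rv inv L) = wgt wt L := by
  induction L with
  | nil => simp [rv]
  | cons a L ih =>
    have : rv inv (a :: L) = rv inv L ++ [inv a] := by simp [rv]
    rw [this, wgt_append, ih]; simp [hinv, add_comm]

lemma Com.commute {inv : J → J} (hinv : ∀ j, e (inv j) = (e j)⁻¹) (hinvw : ∀ j, wt (inv j) = wt j)
    {X Y : Set Γ} {K : ℕ} (hC : Com e wt X Y K) {a b : ℕ} (hab : a + b ≤ K) {z w : Γ}
    (hz : z ∈ Sb e wt X a) (hw : w ∈ Sb e wt Y b) : Commute z w := by
  refine commute_closure ?_ hz hw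
  rintro _ ⟨L, hL, x, hx, rfl⟩ _ ⟨L', hL', y, hy, rfl⟩
  have := hC x hx y hy (rv inv L ++ L') (by rw [wgt_append, wgt_rv hinvw]; omega)
  rw [← commute_conj_iff (c := ev e L)] at this
  simpa [ev_rv hinv, mul_assoc] using this

/-- pushing conjugation by `ς` through a word -/
lemma push_word {X Y : Set Γ} {K C C' : ℕ}
    (hcom : ∀ a b : ℕ, a + b ≤ K → ∀ z ∈ Sb e wt X a, ∀ w ∈ Sb e wt Y b, Commute z w)
    {s : Γ} (T : Set J) (hT1 : ∀ j ∈ T, wt j = 1)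
    (hx : ∀ x ∈ X, s * x * s⁻¹ ∈ Sb e wt X C)
    (ht : ∀ i ∈ T, ∃ ξ ∈ Sb e wt X C, ∃ η ∈ Sb e wt Y C', s * e i * s⁻¹ = e i * (ξ * η))
    (g : List J) (hg : ∀ i ∈ g, i ∈ T) (hK : g.length + C + C' ≤ K) {x : Γ} (hxX : x ∈ X) :
    s * (ev e g * x * (ev e g)⁻¹) * s⁻¹ ∈ Sb e wt X (g.length + C) := by
  induction g with
  | nil => simpa using hx x hxX
  | cons i g ih =>
    have hg' : ∀ j ∈ g, j ∈ T := fun j hj => hg j (by simp [hj])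
    simp only [List.length_cons] at hK
    have hz := ih hg' (by omega)
    set z := s * (ev e g * x * (ev e g)⁻¹) * s⁻¹ with hzdef
    obtain ⟨ξ, hξ, η, hη, hst⟩ := ht i (hg i (by simp))
    have h1 : s * (ev e (i :: g) * x * (ev e (i :: g))⁻¹) * s⁻¹
        = (s * e i * s⁻¹) * z * (s * e i * s⁻¹)⁻¹ := by
      simp [hzdef, mul_assoc]
    have hc : Commute z η := hcom (g.length + C) C' (by omega) z hz η hη
    have h2 : (s * e i * s⁻¹) * z * (s * e i * s⁻¹)⁻¹ = ev e [i] * (ξ * z * ξ⁻¹) * (ev e [i])⁻¹ := by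
      rw [hst]
      have : η * z * η⁻¹ = z := by rw [← hc.eq]; group
      calc _ = e i * (ξ * (η * z * η⁻¹) * ξ⁻¹) * (e i)⁻¹ := by group
        _ = _ := by rw [this]; simp
    rw [h1, h2]
    refine conj_mem_Sb (a := g.length + C) [i] ?_ ?_
    · have hξ' := Sb_mono (e := e) (wt := wt) (Z := X) (show C ≤ g.length + C by omega) hξ
      exact mul_mem (mul_mem hξ' hz) (inv_mem hξ')
    · simp [hT1 i (hg i (by simp))]; omega

/-- Local data for the commuting lemma. -/
structure Data (e : J → Γ) (wt : J → ℕ) (X Y : Set Γ) (T : Set J) (C C' N : ℕ) : Prop where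
  comm : ∀ i j, ∃ ξ ∈ Sb e wt X 0, ∃ η ∈ Sb e wt Y 0, e i * e j = e j * e i * (ξ * η)
  V : ∀ j, j ∉ T → ∀ x ∈ X, (e j)⁻¹ * x * e j ∈ Sb e wt X (wt j - 1)
  T : ∀ j ∈ T, ∃ s : Γ, (∀ x ∈ X, s * x * s⁻¹ ∈ Sb e wt X C) ∧
    (∀ i ∈ T, ∃ ξ ∈ Sb e wt X C, ∃ η ∈ Sb e wt Y C', s * e i * s⁻¹ = e i * (ξ * η)) ∧
    (∀ y ∈ Y, (s * e j ^ N) * y * (s * e j ^ N)⁻¹ ∈ Sb e wt Y C) ∧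
    (∀ i ∈ T, ∃ η ∈ Sb e wt Y C, ∃ ξ ∈ Sb e wt X C',
      (s * e j ^ N) * e i * (s * e j ^ N)⁻¹ = e i * (η * ξ))

lemma Sb_zero_le_closure {Z : Set Γ} (hpos : ∀ j, 1 ≤ wt j) :
    Sb e wt Z 0 ≤ Subgroup.closure Z := by
  rw [Sb, Subgroup.closure_le]
  rintro g ⟨L, hL, z, hz, rfl⟩
  cases L with
  | nil => simpa using Subgroup.subset_closure hz
  | cons a L => have := hpos a; simp at hL; omega

lemma ev_replicate (n : ℕ) (j : J) : ev e (List.replicate n j) = e j ^ n := by simp [ev]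

lemma com_swap {inv : J → J} (hinv : ∀ j, e (inv j) = (e j)⁻¹)
    (hinvw : ∀ j, wt (inv j) = wt j) (hpos : ∀ j, 1 ≤ wt j)
    {X Y : Set Γ} {K : ℕ} (hC : Com e wt X Y K)
    (hcomm : ∀ i j, ∃ ξ ∈ Sb e wt X 0, ∃ η ∈ Sb e wt Y 0, e i * e j = e j * e i * (ξ * η))
    {L L' : List J} (h : L.Perm L') : ∀ p : List J, wgt wt (p ++ L) ≤ K + 1 →
    (∀ x ∈ X, ∀ y ∈ Y, Commute x (ev e (p ++ L) * y * (ev e (p ++ L))⁻¹)) →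
    (∀ x ∈ X, ∀ y ∈ Y, Commute x (ev e (p ++ L') * y * (ev e (p ++ L'))⁻¹)) := by
  induction h with
  | nil => intro p _ h; exact h
  | cons a h ih =>
    intro p hw hp
    have := ih (p ++ [a]) (by simpa using hw) (by simpa using hp)
    simpa using this
  | trans h1 h2 ih1 ih2 =>
    intro p hw hp
    refine ih2 p ?_ (ih1 p hw hp)
    rw [← wgt_perm (List.Perm.append_left p h1)]; exact hw
  | swap j i r =>
    -- `i :: j :: r` to `j :: i :: r`
    intro p hw hp x hx y hy
    obtain ⟨ξ, hξ, η, hη, hij⟩ := hcomm j i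
    have hwi := hpos i
    have hwj := hpos j
    simp only [wgt_append, wgt_cons] at hw
    set q := ev e p * (e i * e j) with hq
    have e1 : ∀ y, ev e (p ++ i :: j :: r) * y * (ev e (p ++ i :: j :: r))⁻¹
        = q * (ev e r * y * (ev e r)⁻¹) * q⁻¹ := by intro y; simp [hq, mul_assoc]
    have e2 : ev e (p ++ j :: i :: r) * y * (ev e (p ++ j :: i :: r))⁻¹
        = q * ((ξ * η) * (ev e r * y * (ev e r)⁻¹) * (ξ * η)⁻¹) * q⁻¹ := by
      have : ev e (p ++ j :: i :: r) = q * (ξ * η) * ev e r := by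
        simp only [ev_append, ev_cons, hq, mul_assoc]
        rw [← mul_assoc (e j), hij]; simp [mul_assoc]
      rw [this]; group
    have hyr : ev e r * y * (ev e r)⁻¹ ∈ Sb e wt Y (wgt wt r) := mem_Sb hy le_rfl
    set w := ev e r * y * (ev e r)⁻¹ with hwdef
    have hηr : η ∈ Sb e wt Y (wgt wt r) := Sb_mono (Nat.zero_le _) hη
    have hcξ : Commute ξ (η * w * η⁻¹) :=
      hC.commute hinv hinvw (a := 0) (b := wgt wt r) (by omega) hξ
        (mul_mem (mul_mem hηr hyr) (inv_mem hηr))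
    have e3 : (ξ * η) * w * (ξ * η)⁻¹ = η * w * η⁻¹ := by
      calc _ = ξ * (η * w * η⁻¹) * ξ⁻¹ := by group
        _ = _ := by rw [hcξ.eq]; group
    rw [e2, e3]
    have key : ∀ v, Commute x (q * v * q⁻¹) ↔ Commute (q⁻¹ * x * q) v := by
      intro v
      rw [← commute_conj_iff (c := q) (a := q⁻¹ * x * q)]
      simp [mul_assoc]
    rw [key]
    have hw' : Commute (q⁻¹ * x * q) w := by rw [← key, hwdef, ← e1]; exact hp x hx y hy
    have hηc : Commute (q⁻¹ * x * q) η := by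
      rcases r with _ | ⟨a, r⟩
      · refine commute_closure (S := {q⁻¹ * x * q}) (T := Y) ?_
          (Subgroup.subset_closure rfl) (Sb_zero_le_closure hpos hη)
        rintro s rfl t ht
        rw [← key]
        have := hp x hx t ht
        rw [e1] at this
        simpa using this
      · have hqev : q = ev e (p ++ [i, j]) := by simp [hq]
        have hx' : q⁻¹ * x * q ∈ Sb e wt X (wgt wt (p ++ [i, j])) := by
          have := mem_Sb (e := e) (wt := wt) hx (L := rv inv (p ++ [i, j]))
            (n := wgt wt (p ++ [i, j])) (by rw [wgt_rv hinvw])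
          rw [ev_rv hinv, ← hqev] at this
          simpa using this
        have := hpos a
        refine hC.commute hinv hinvw (a := wgt wt (p ++ [i, j])) (b := 0) ?_ hx' hη
        simp at hw ⊢; omega
    exact (hηc.mul_right hw').mul_right hηc.inv_right

lemma length_eq_wgt {T : Set J} (hT1 : ∀ j ∈ T, wt j = 1) (L : List J) (h : ∀ i ∈ L, i ∈ T) :
    wgt wt L = L.length := by
  induction L with
  | nil => rfl
  | cons a L ih =>
    simp [hT1 a (h a (by simp)), ih (fun i hi => h i (by simp [hi])), add_comm]

/-- The commuting lemma. -/
lemma com_all [Fintype J] {inv : J → J} (hinv : ∀ j, e (inv j) = (e j)⁻¹)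
    (hinvw : ∀ j, wt (inv j) = wt j) (hpos : ∀ j, 1 ≤ wt j)
    {X Y : Set Γ} {T : Set J} (hT1 : ∀ j ∈ T, wt j = 1)
    (hTinv : ∀ j ∈ T, inv j ∈ T) {C C' N : ℕ}
    (hN : 2 * C + 1 ≤ N) (hD : Data e wt X Y T C C' N) (K₀ : ℕ)
    (hK₀ : 2 * (C + C') + 4 + Fintype.card J * N ≤ K₀) (h0 : Com e wt X Y K₀) :
    ∀ K, Com e wt X Y K := by
  classical
  have main : ∀ K, K₀ ≤ K → Com e wt X Y K := by
    intro K hK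
    induction K, hK using Nat.le_induction with
    | base => exact h0
    | succ K hK hC =>
      have hcom : ∀ a b : ℕ, a + b ≤ K → ∀ z ∈ Sb e wt X a, ∀ w ∈ Sb e wt Y b, Commute z w :=
        fun a b hab z hz w hw => hC.commute hinv hinvw hab hz hw
      intro x hx y hy L hL
      by_cases hLK : wgt wt L ≤ K
      · exact hC x hx y hy L hLK
      have hLK1 : wgt wt L = K + 1 := by omega
      by_cases hV : ∃ j ∈ L, j ∉ T
      · obtain ⟨j, hjL, hjT⟩ := hV
        have hperm := List.perm_cons_erase hjL
        have hw := wgt_perm (wt := wt) hperm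
        simp only [wgt_cons] at hw
        refine com_swap hinv hinvw hpos hC hD.comm hperm.symm [] ?_ ?_ x hx y hy
        · simp; omega
        · intro x hx y hy
          have h1 := hD.V j hjT x hx
          have h2 := mem_Sb (e := e) (wt := wt) hy (L := L.erase j) le_rfl
          have := hpos j
          have h3 := hcom (wt j - 1) (wgt wt (L.erase j)) (by omega) _ h1 _ h2
          rw [← commute_conj_iff (c := e j)] at h3
          simpa [mul_assoc] using h3
      · push Not at hV
        have hlen := length_eq_wgt hT1 L hV
        -- pigeonhole
        obtain ⟨j, hj⟩ : ∃ j, N ≤ L.count j := by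
          by_contra hcon
          push Not at hcon
          have h1 : L.length = ∑ j : J, L.count j := by
            have := Multiset.sum_count_eq_card (s := Finset.univ) (m := (L : Multiset J))
              (fun a _ => Finset.mem_univ a)
            simpa using this.symm
          have h2 : ∑ j : J, L.count j ≤ ∑ _j : J, N := Finset.sum_le_sum (fun j _ => (hcon j).le)
          simp at h2
          omega
        have hsub : (List.replicate N j).Sublist L := List.replicate_sublist_iff.2 hj
        obtain ⟨h, hperm⟩ := hsub.exists_perm_append
        by_cases hN0 : N = 0
        · omega
        have hjT : j ∈ T := hV j (hperm.symm.subset (by simp [hN0]))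
        have hhT : ∀ i ∈ h, i ∈ T := fun i hi => hV i (hperm.symm.subset (by simp [hi]))
        have hlen2 : L.length = N + h.length := by rw [hperm.length_eq]; simp
        set h1 := h.take (h.length / 2) with hh1
        set h2 := h.drop (h.length / 2) with hh2
        have hh12 : h1 ++ h2 = h := List.take_append_drop _ _
        have l1 : h1.length = h.length / 2 := by simp [hh1]; omega
        have l2 : h2.length = h.length - h.length / 2 := by simp [hh2]
        have h1T : ∀ i ∈ h1, i ∈ T := fun i hi => hhT i (List.take_subset _ _ hi)
        have h2T : ∀ i ∈ h2, i ∈ T := fun i hi => hhT i (List.drop_subset _ _ hi)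
        have hp2 : L.Perm (h1 ++ (List.replicate N j ++ h2)) := by
          refine hperm.trans ?_
          rw [← hh12, ← List.append_assoc, ← List.append_assoc]
          exact (List.perm_append_comm).append_right h2
        refine com_swap hinv hinvw hpos hC hD.comm hp2.symm [] ?_ ?_ x hx y hy
        · rw [List.nil_append, ← wgt_perm hp2]; omega
        intro x hx y hy
        obtain ⟨s, s1, s2, s3, s4⟩ := hD.T j hjT
        have h1T' : ∀ i ∈ rv inv h1, i ∈ T := by
          intro i hi
          simp only [rv, List.mem_reverse, List.mem_map] at hi
          obtain ⟨a, ha, rfl⟩ := hi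
          exact hTinv a (h1T a ha)
        have l1' : (rv inv h1).length = h1.length := by simp [rv]
        have A := push_word hcom T hT1 s1 s2 (rv inv h1) h1T' (by omega) hx
        have B := push_word (K := K) (fun a b hab z hz w hw => (hcom b a (by omega) w hw z hz).symm)
          T hT1 s3 s4 h2 h2T (by omega) hy
        have hc := hcom _ _ (by omega) _ A _ B
        rw [← commute_conj_iff (c := ev e h1 * s⁻¹)] at hc
        simpa [ev_rv hinv, ev_replicate, mul_assoc] using hc
  intro K x hx y hy L hL
  exact main (max K K₀) (le_max_right _ _) x hx y hy L (hL.trans (le_max_left _ _))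

end Words
end FibreProd

namespace FibreProd

section Noeth
open scoped commutatorElement
variable {G : Type*} [Group G]

/-- A normal subgroup of a finitely generated group, contained in an abelian, finitely normally
generated normal subgroup centralized by the commutator subgroup is finitely normally generated. -/
lemma fng_of_le_abelian [Group.FG G] (R : Subgroup G) [hRn : R.Normal]
    (hab : ∀ r ∈ R, ∀ s ∈ R, r * s = s * r)
    (hcen : ∀ g ∈ commutator G, ∀ r ∈ R, g * r = r * g)
    (hR : R.IsFinitelyNormallyGenerated) (C : Subgroup G) (hCn : C.Normal) (hCR : C ≤ R) :
    C.IsFinitelyNormallyGenerated := by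
  letI : CommGroup R := { (inferInstance : Group R) with
    mul_comm := fun a b => Subtype.ext (hab a a.2 b b.2) }
  let Q := G ⧸ commutator G
  letI : CommGroup Q := (inferInstance : CommGroup (Abelianization G))
  haveI : Group.FG Q := QuotientGroup.fg _
  let A := Additive R
  -- action on A
  let toEnd : MulAut R →* Module.End ℤ A :=
    { toFun := fun f => (MonoidHom.toAdditive f.toMonoidHom).toIntLinearMap
      map_one' := rfl
      map_mul' := fun _ _ => rfl }
  let act : Q →* Module.End ℤ A := toEnd.comp (QuotientGroup.lift (commutator G)
    (MulAut.conjNormal (H := R)) (by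
      intro g hg
      ext r
      have := hcen g hg r r.2
      simp [MulAut.conjNormal_apply, this]))
  have act_apply : ∀ (g : G) (a : A), ((act (QuotientGroup.mk g) a).toMul : G)
      = g * (a.toMul : G) * g⁻¹ := by
    intro g a
    rfl
  let ρ : MonoidAlgebra ℤ Q →ₐ[ℤ] Module.End ℤ A := MonoidAlgebra.lift ℤ _ Q act
  letI : Module (MonoidAlgebra ℤ Q) A := Module.compHom A ρ.toRingHom
  have smul_def' : ∀ (c : MonoidAlgebra ℤ Q) (a : A), c • a = ρ c a := fun _ _ => rfl
  haveI : IsNoetherianRing (MonoidAlgebra ℤ Q) := by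
    have : Algebra.FiniteType ℤ (MonoidAlgebra ℤ Q) := inferInstance
    exact Algebra.FiniteType.isNoetherianRing ℤ _
  -- normal subgroups to submodules
  let toSub : ∀ D : Subgroup G, D.Normal → Submodule (MonoidAlgebra ℤ Q) A := fun D hD =>
    { carrier := {a | (a.toMul : G) ∈ D}
      add_mem' := fun {a b} ha hb => by
        exact D.mul_mem ha hb
      zero_mem' := by simp
      smul_mem' := by
        intro c a ha
        induction c using MonoidAlgebra.induction_on with
        | of q =>
          obtain ⟨g, rfl⟩ := QuotientGroup.mk_surjective q
          rw [smul_def']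
          have : ρ (MonoidAlgebra.of ℤ Q (QuotientGroup.mk g)) = act (QuotientGroup.mk g) := by
            simp [ρ]
          rw [this, Set.mem_setOf_eq, act_apply]
          exact hD.conj_mem _ ha g
        | add x y hx hy =>
          rw [add_smul]
          exact D.mul_mem hx hy
        | smul r x hx =>
          have : (r • x) • a = r • (x • a) := by
            rw [smul_def', smul_def', map_smul]; rfl
          rw [this]
          exact D.zpow_mem hx r }
  have mem_toSub : ∀ D hD a, a ∈ toSub D hD ↔ (a.toMul : G) ∈ D := fun _ _ _ => Iff.rfl
  -- normal closure vs span
  have span_le : ∀ (S : Set G) (hS : S ⊆ R) (a : A),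
      a ∈ Submodule.span (MonoidAlgebra ℤ Q) {a : A | (a.toMul : G) ∈ S} ↔
        (a.toMul : G) ∈ Subgroup.normalClosure S := by
    intro S hS a
    constructor
    · intro h
      have : Submodule.span (MonoidAlgebra ℤ Q) {a : A | (a.toMul : G) ∈ S}
          ≤ toSub (Subgroup.normalClosure S) inferInstance := by
        rw [Submodule.span_le]
        intro b hb
        exact Subgroup.subset_normalClosure hb
      exact this h
    · intro h
      set M := Submodule.span (MonoidAlgebra ℤ Q) {a : A | (a.toMul : G) ∈ S} with hM
      let D : Subgroup G :=
        { carrier := {g | ∃ a ∈ M, (a.toMul : G) = g}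
          mul_mem' := by
            rintro _ _ ⟨a, ha, rfl⟩ ⟨b, hb, rfl⟩
            exact ⟨a + b, add_mem ha hb, rfl⟩
          one_mem' := ⟨0, zero_mem _, rfl⟩
          inv_mem' := by
            rintro _ ⟨a, ha, rfl⟩
            exact ⟨-a, neg_mem ha, rfl⟩ }
      have hDn : D.Normal := by
        constructor
        rintro _ ⟨a, ha, rfl⟩ g
        refine ⟨MonoidAlgebra.of ℤ Q (QuotientGroup.mk g) • a, M.smul_mem _ ha, ?_⟩
        rw [smul_def']
        have : ρ (MonoidAlgebra.of ℤ Q (QuotientGroup.mk g)) = act (QuotientGroup.mk g) := by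
          simp [ρ]
        rw [this, act_apply]
      have hle : Subgroup.normalClosure S ≤ D := by
        apply Subgroup.normalClosure_le_normal
        intro g hg
        exact ⟨Additive.ofMul ⟨g, hS hg⟩, Submodule.subset_span hg, rfl⟩
      obtain ⟨b, hb, hba⟩ := hle h
      have : b = a := by
        apply Additive.toMul.injective
        exact Subtype.ext hba
      rwa [← this]
  -- finiteness
  obtain ⟨S, hSf, hSR⟩ := hR
  have hSsub : S ⊆ R := by rw [← hSR]; exact Subgroup.subset_normalClosure
  have finS : ∀ S : Set G, S.Finite → {a : A | (a.toMul : G) ∈ S}.Finite := by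
    intro S hS
    refine hS.preimage (f := fun a : A => (a.toMul : G)) ?_
    intro a _ b _ h
    exact Additive.toMul.injective (Subtype.ext h)
  haveI : Module.Finite (MonoidAlgebra ℤ Q) A := by
    refine ⟨⟨(finS S hSf).toFinset, ?_⟩⟩
    rw [Set.Finite.coe_toFinset, eq_top_iff]
    intro a _
    rw [span_le S hSsub, hSR]
    exact a.toMul.2
  haveI : IsNoetherian (MonoidAlgebra ℤ Q) A := isNoetherian_of_isNoetherianRing_of_finite _ _
  obtain ⟨Φ, hΦ⟩ := IsNoetherian.noetherian (toSub C hCn)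
  refine ⟨(fun a : A => (a.toMul : G)) '' (Φ : Set A), Φ.finite_toSet.image _, ?_⟩
  have himg : {a : A | (a.toMul : G) ∈ (fun a : A => (a.toMul : G)) '' (Φ : Set A)} = Φ := by
    ext a
    constructor
    · rintro ⟨b, hb, hba⟩
      have : b = a := Additive.toMul.injective (Subtype.ext hba)
      rwa [← this]
    · intro h; exact ⟨a, h, rfl⟩
  have hsub : (fun a : A => (a.toMul : G)) '' (Φ : Set A) ⊆ R := by
    rintro _ ⟨a, _, rfl⟩; exact a.toMul.2
  ext g
  constructor
  · intro hg
    have hgR : g ∈ R := (Subgroup.normalClosure_le_normal (N := R) hsub) hg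
    have := (span_le _ hsub (Additive.ofMul ⟨g, hgR⟩)).2 hg
    rw [himg, hΦ] at this
    exact this
  · intro hg
    have : (Additive.ofMul ⟨g, hCR hg⟩ : A) ∈ toSub C hCn := hg
    rw [← hΦ, ← himg] at this
    exact (span_le _ hsub _).1 this

/-- finitely normally generated modulo a normal subgroup -/
lemma fng_mod [Group.FG G] (R E : Subgroup G) [hRn : R.Normal] [hEn : E.Normal] (hRE : R ≤ E)
    (hE : commutator G ≤ E) (hR : R.IsFinitelyNormallyGenerated) (C : Subgroup G) (hCn : C.Normal)
    (hCR : C ≤ R) :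
    ∃ Φ : Set G, Φ.Finite ∧ Φ ⊆ C ∧ C ≤ Subgroup.normalClosure Φ ⊔ ⁅R, E⁆ := by
  let π := QuotientGroup.mk' ⁅R, E⁆
  have hπ : Function.Surjective π := QuotientGroup.mk'_surjective _
  have hker : π.ker = ⁅R, E⁆ := QuotientGroup.ker_mk' _
  have hcomm : ∀ r ∈ R, ∀ s ∈ E, π r * π s = π s * π r := by
    intro r hr s hs
    have : ⁅r, s⁆ ∈ π.ker := by rw [hker]; exact Subgroup.commutator_mem_commutator hr hs
    rw [MonoidHom.mem_ker, map_commutatorElement, commutatorElement_eq_one_iff_mul_comm] at this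
    exact this
  haveI : (R.map π).Normal := hRn.map π hπ
  have hfg : Group.FG (G ⧸ ⁅R, E⁆) := QuotientGroup.fg _
  obtain ⟨S, hSf, hS⟩ := fng_of_le_abelian (R.map π)
    (by
      rintro _ ⟨r, hr, rfl⟩ _ ⟨s, hs, rfl⟩
      exact hcomm r hr s (hRE hs))
    (by
      intro g hg
      have h2 : g ∈ (commutator G).map π := by
        rw [commutator_def, Subgroup.map_commutator, Subgroup.map_top_of_surjective _ hπ]
        exact hg
      obtain ⟨x, hx, rfl⟩ := h2
      rintro _ ⟨r, hr, rfl⟩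
      exact (hcomm r hr x (hE hx)).symm)
    (hR.map hπ) (C.map π) (hCn.map π hπ) (Subgroup.map_mono hCR)
  have hSC : S ⊆ π '' (C : Set G) := by
    have : S ⊆ (C.map π : Subgroup _) := by rw [← hS]; exact Subgroup.subset_normalClosure
    simpa using this
  obtain ⟨Φ, hΦC, hΦf, hΦS⟩ := Set.exists_subset_image_finite_and.1 ⟨S, hSC, hSf, rfl⟩
  refine ⟨Φ, hΦf, hΦC, ?_⟩
  have h1 : C.map π = (Subgroup.normalClosure Φ).map π := by
    rw [Subgroup.map_normalClosure _ _ hπ, ← hΦS, hS]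
  calc C ≤ (C.map π).comap π := Subgroup.le_comap_map _ _
    _ = _ := by rw [h1, Subgroup.comap_map_eq, hker]

end Noeth
end FibreProd

namespace FibreProd

section ThmA
open scoped commutatorElement
variable {F : Type*} [Group F]

lemma agree_mod {A : Type*} [Group A] (R₁ R₂ W : Subgroup F) [W.Normal]
    (hW : ⁅R₁, R₂⁆ ≤ W) (α β : A →* F) (hα : ∀ a, α a ∈ R₁) (hβ : ∀ a, β a ∈ R₁)
    (hd : ∀ a, (α a)⁻¹ * β a ∈ R₂) : ∀ c ∈ commutator A, (α c)⁻¹ * β c ∈ W := by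
  let q := QuotientGroup.mk' W
  have hq : ∀ x, q x = 1 ↔ x ∈ W := fun x => by
    rw [← MonoidHom.mem_ker, QuotientGroup.ker_mk']
  have hcomm : ∀ r ∈ R₁, ∀ s ∈ R₂, q r * q s = q s * q r := by
    intro r hr s hs
    have : ⁅r, s⁆ ∈ W := hW (Subgroup.commutator_mem_commutator hr hs)
    rw [← hq, map_commutatorElement, commutatorElement_eq_one_iff_mul_comm] at this
    exact this
  have key : commutator A ≤ (q.comp α).eqLocus (q.comp β) := by
    rw [commutator_def, Subgroup.commutator_le]
    intro a _ b _
    show q (α ⁅a, b⁆) = q (β ⁅a, b⁆)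
    rw [map_commutatorElement, map_commutatorElement, map_commutatorElement,
      map_commutatorElement]
    set x := q (α a)
    set y := q (α b)
    set z := q ((α a)⁻¹ * β a) with hz
    set w := q ((α b)⁻¹ * β b) with hw
    have e1 : q (β a) = x * z := by simp [hz, x]
    have e2 : q (β b) = y * w := by simp [hw, y]
    rw [e1, e2]
    have c1 : y * z = z * y := hcomm _ (hα b) _ (hd a)
    have c2 : x * w = w * x := hcomm _ (hα a) _ (hd b)
    have c3 : w * z = z * w := hcomm _ (R₁.mul_mem (R₁.inv_mem (hα b)) (hβ b)) _ (hd a)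
    rw [commutatorElement_def, commutatorElement_def]
    have : x * z * (y * w) = x * y * (w * z) := by
      rw [c3, mul_assoc x y, ← mul_assoc y, c1]; group
    have h2 : y * w * (x * z) = y * x * (w * z) := by
      rw [mul_assoc y w, ← mul_assoc w x, ← c2]; group
    have h3 : x * z * (y * w) * (x * z)⁻¹ * (y * w)⁻¹
        = (x * z * (y * w)) * (y * w * (x * z))⁻¹ := by group
    rw [h3, this, h2]; group
  intro c hc
  have := key hc
  rw [← hq, map_mul, map_inv]
  have h' : q (α c) = q (β c) := this
  rw [h']; simp

theorem thmA [IsFreeGroup F] [Group.FG F] (R₁ R₂ W : Subgroup F) [hR₁ : R₁.Normal]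
    [hR₂ : R₂.Normal] [hWn : W.Normal] (hf₁ : R₁.IsFinitelyNormallyGenerated)
    (hf₂ : R₂.IsFinitelyNormallyGenerated) (hfW : W.IsFinitelyNormallyGenerated)
    (hE : commutator F ≤ R₁ ⊔ R₂) (hW : ⁅R₁, R₂⁆ ≤ W) (hWD : W ≤ R₁ ⊓ R₂) :
    (R₁ ⊓ R₂).IsFinitelyNormallyGenerated := by
  obtain ⟨Φ₁, hΦ₁f, hΦ₁D, hΦ₁⟩ := fng_mod R₁ (R₁ ⊔ R₂) le_sup_left hE hf₁ (R₁ ⊓ R₂)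
    inferInstance inf_le_left
  obtain ⟨Φ₂, hΦ₂f, hΦ₂C, hΦ₂⟩ := fng_mod R₂ (R₁ ⊔ R₂) le_sup_right hE hf₂
    (⁅R₁ ⊔ R₂, R₁ ⊔ R₂⁆ ⊓ R₂) inferInstance inf_le_right
  obtain ⟨ΦW, hΦWf, hΦW⟩ := hfW
  set E := R₁ ⊔ R₂ with hEdef
  have hEn : E.Normal := inferInstance
  haveI : IsFreeGroup E := subgroupIsFreeOfIsFree E
  have hsplit : ∀ e : E, ∃ r : R₁, (r : F)⁻¹ * e ∈ R₂ := by
    rintro ⟨e, he⟩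
    obtain ⟨y, hy, z, hz, rfl⟩ := Subgroup.mem_sup_of_normal_right.1 he
    exact ⟨⟨y, hy⟩, by simpa using hz⟩
  choose sp hsp using hsplit
  let θ : E →* R₁ := IsFreeGroup.lift (fun x => sp (IsFreeGroup.of x))
  let θ' : E →* F := R₁.subtype.comp θ
  have hθ1 : ∀ e, θ' e ∈ R₁ := fun e => (θ e).2
  have hθ2 : ∀ e : E, (θ' e)⁻¹ * e ∈ R₂ := by
    have : (QuotientGroup.mk' R₂).comp θ' = (QuotientGroup.mk' R₂).comp E.subtype := by
      apply IsFreeGroup.ext_hom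
      intro a
      have := hsp (IsFreeGroup.of a)
      simp only [MonoidHom.comp_apply, θ', θ, IsFreeGroup.lift_of, Subgroup.subtype_apply,
        QuotientGroup.mk'_apply]
      exact QuotientGroup.eq.2 this
    intro e
    have := DFunLike.congr_fun this e
    exact QuotientGroup.eq.1 this
  have hθD : ∀ e : E, (e : F) ∈ R₂ → θ' e ∈ R₂ := by
    intro e he
    have := R₂.mul_mem he (R₂.inv_mem (hθ2 e))
    simpa using this
  let Ψ : Set F := θ' '' {e : E | (e : F) ∈ Φ₂}
  have hΨf : Ψ.Finite := (hΦ₂f.preimage Subtype.val_injective.injOn).image _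
  have hΨD : Ψ ⊆ (R₁ ⊓ R₂ : Subgroup F) := by
    rintro _ ⟨e, he, rfl⟩
    exact ⟨hθ1 e, hθD e (hΦ₂C he).2⟩
  let V : Subgroup F := Subgroup.normalClosure (Φ₁ ∪ ΦW ∪ Ψ)
  have hWV : W ≤ V := by
    rw [← hΦW]
    exact Subgroup.normalClosure_mono (fun x hx => Or.inl (Or.inr hx))
  have hΦ₁V : Subgroup.normalClosure Φ₁ ≤ V :=
    Subgroup.normalClosure_mono (fun x hx => Or.inl (Or.inl hx))
  have hΨV : Ψ ⊆ V := fun x hx => Subgroup.subset_normalClosure (Or.inr hx)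
  refine ⟨Φ₁ ∪ ΦW ∪ Ψ, (hΦ₁f.union hΦWf).union hΨf, le_antisymm ?_ ?_⟩
  · apply Subgroup.normalClosure_le_normal
    intro x hx
    rcases hx with (hx | hx) | hx
    · exact hΦ₁D hx
    · apply hWD; rw [← hΦW]; exact Subgroup.subset_normalClosure hx
    · exact hΨD hx
  change R₁ ⊓ R₂ ≤ V
  have hEE : (commutator E).map E.subtype = ⁅E, E⁆ := by
    rw [commutator_def, Subgroup.map_commutator, ← MonoidHom.range_eq_map, E.range_subtype]
  let U : Subgroup F := (commutator E ⊓ V.comap θ').map E.subtype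
  have hUn : U.Normal := by
    constructor
    rintro _ ⟨e, ⟨he, heV⟩, rfl⟩ f
    let cj : E →* E := (MulAut.conjNormal f).toMonoidHom
    have hcj : ∀ e : E, (cj e : F) = f * e * f⁻¹ := fun e => rfl
    refine ⟨cj e, ⟨?_, ?_⟩, rfl⟩
    · have : (commutator E).map cj ≤ commutator E := by
        rw [commutator_def, Subgroup.map_commutator]
        exact Subgroup.commutator_mono le_top le_top
      exact this ⟨e, he, rfl⟩
    · have h := agree_mod R₁ R₂ W hW ((MulAut.conj f).toMonoidHom.comp θ') (θ'.comp cj)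
        (fun a => hR₁.conj_mem _ (hθ1 a) f) (fun a => hθ1 _) (by
          intro a
          have h1 := hR₂.conj_mem _ (hθ2 a) f
          have h2 := hθ2 (cj a)
          rw [hcj] at h2
          have h3 := R₂.mul_mem h1 (R₂.inv_mem h2)
          have : f * ((θ' a)⁻¹ * ↑a) * f⁻¹ * ((θ' (cj a))⁻¹ * (f * ↑a * f⁻¹))⁻¹
             = (f * θ' a * f⁻¹)⁻¹ * θ' (cj a) := by group
          rw [this] at h3
          exact h3) e he
      have h1 : f * θ' e * f⁻¹ ∈ V :=
        (inferInstance : V.Normal).conj_mem _ heV f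
      have h2 := V.mul_mem h1 (hWV h)
      have h3 : f * θ' e * f⁻¹ * ((((MulAut.conj f).toMonoidHom.comp θ') e)⁻¹
        * (θ'.comp cj) e) = θ' (cj e) := by
        show f * θ' e * f⁻¹ * ((f * θ' e * f⁻¹)⁻¹ * θ' (cj e)) = θ' (cj e)
        group
      rw [h3] at h2
      exact h2
  have hΦ₂U : Subgroup.normalClosure Φ₂ ≤ U := by
    apply Subgroup.normalClosure_le_normal
    intro x hx
    have h1 := (hΦ₂C hx).1
    rw [← hEE] at h1
    obtain ⟨e, he, rfl⟩ := h1
    exact ⟨e, ⟨he, hΨV ⟨e, hx, rfl⟩⟩, rfl⟩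
  have hRU : ⁅R₂, E⁆ ≤ U := by
    rw [Subgroup.commutator_le]
    intro r hr e he
    let r' : E := ⟨r, (le_sup_right : R₂ ≤ R₁ ⊔ R₂) hr⟩
    let e' : E := ⟨e, he⟩
    refine ⟨⁅r', e'⁆, ⟨Subgroup.commutator_mem_commutator trivial trivial, ?_⟩, rfl⟩
    show θ' ⁅r', e'⁆ ∈ V
    rw [map_commutatorElement]
    apply hWV; apply hW
    rw [Subgroup.commutator_comm]
    exact Subgroup.commutator_mem_commutator (hθD r' hr) (hθ1 _)
  have hC2 : ∀ c ∈ ⁅R₁, R₁⁆, c ∈ R₂ → c ∈ V := by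
    intro c hc hc2
    have h1 : c ∈ U := (sup_le hΦ₂U hRU) (hΦ₂ ⟨Subgroup.commutator_mono le_sup_left le_sup_left hc,
      hc2⟩)
    obtain ⟨e, ⟨he, heV⟩, rfl⟩ := h1
    have hRR : (commutator R₁).map R₁.subtype = ⁅R₁, R₁⁆ := by
      rw [commutator_def, Subgroup.map_commutator, ← MonoidHom.range_eq_map, R₁.range_subtype]
    rw [← hRR] at hc
    obtain ⟨c', hc', hce⟩ := hc
    have h := agree_mod R₁ R₂ W hW (θ'.comp (Subgroup.inclusion (le_sup_left : R₁ ≤ E)))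
      R₁.subtype (fun a => hθ1 _) (fun a => a.2) (fun a => hθ2 _) c' hc'
    have hec : Subgroup.inclusion (le_sup_left : R₁ ≤ E) c' = e := Subtype.ext hce
    have h2 : θ' e * ((θ' (Subgroup.inclusion (le_sup_left : R₁ ≤ E) c'))⁻¹ * R₁.subtype c') ∈ V :=
      V.mul_mem heV (hWV h)
    rw [hec, mul_inv_cancel_left, hce] at h2
    exact h2
  have hR₁E : ⁅R₁, E⁆ ≤ ⁅R₁, R₁⁆ ⊔ ⁅R₁, R₂⁆ := by
    rw [hEdef, Subgroup.commutator_le]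
    intro r hr e he
    obtain ⟨y, hy, z, hz, rfl⟩ := Subgroup.mem_sup_of_normal_right.1 he
    have : ⁅r, y * z⁆ = ⁅r, y⁆ * (y * ⁅r, z⁆ * y⁻¹) := by
      simp only [commutatorElement_def]; group
    rw [this]
    refine Subgroup.mul_mem_sup (Subgroup.commutator_mem_commutator hr hy) ?_
    exact (inferInstance : (⁅R₁, R₂⁆).Normal).conj_mem _
      (Subgroup.commutator_mem_commutator hr hz) _
  intro d hd
  obtain ⟨φ, hφ, c, hc, rfl⟩ := Subgroup.mem_sup_of_normal_right.1 (hΦ₁ hd)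
  obtain ⟨c', hc', w, hw, rfl⟩ := Subgroup.mem_sup_of_normal_right.1 (hR₁E hc)
  have hφD : φ ∈ R₁ ⊓ R₂ := Subgroup.normalClosure_le_normal hΦ₁D hφ
  refine V.mul_mem (hΦ₁V hφ) (V.mul_mem (hC2 c' hc' ?_) (hWV (hW hw)))
  have hw2 := (hWD (hW hw)).2
  have h1 := (R₂.mul_mem_cancel_left hφD.2).1 hd.2
  exact (R₂.mul_mem_cancel_right hw2).1 h1

end ThmA
end FibreProd

namespace FibreProd

section Ker

lemma ker_fng {P G : Type*} [Group P] [Group G] [hG : Group.IsFinitelyPresented G]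
    [hP : Group.FG P] (g : P →* G) (hg : Function.Surjective g) :
    g.ker.IsFinitelyNormallyGenerated := by
  obtain ⟨n, φ, hφ, S, hSf, hS⟩ := hG.out
  obtain ⟨Y, hY⟩ := hP.out
  let α : FreeGroup (Fin n) →* P := FreeGroup.lift (fun i => (hg (φ (FreeGroup.of i))).choose)
  have hα : ∀ x, g (α x) = φ x := by
    have : g.comp α = φ := by
      apply FreeGroup.ext_hom
      intro i
      simp only [MonoidHom.comp_apply, α, FreeGroup.lift_apply_of]
      exact (hg (φ (FreeGroup.of i))).choose_spec
    exact fun x => DFunLike.congr_fun this x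
  choose b hb using fun p : P => hφ (g p)
  let Z : Set P := α '' S ∪ (fun y => y * (α (b y))⁻¹) '' (Y : Set P)
  refine ⟨Z, (hSf.image _).union (Y.finite_toSet.image _), le_antisymm ?_ ?_⟩
  · apply Subgroup.normalClosure_le_normal
    rintro _ (⟨s, hs, rfl⟩ | ⟨y, _, rfl⟩)
    · show g (α s) = 1
      rw [hα]
      have : s ∈ φ.ker := by rw [← hS]; exact Subgroup.subset_normalClosure hs
      exact this
    · show g _ = 1
      rw [map_mul, map_inv, hα, hb, mul_inv_cancel]
  · intro p hp
    let q := QuotientGroup.mk' (Subgroup.normalClosure Z)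
    have hαS : ∀ w ∈ φ.ker, q (α w) = 1 := by
      intro w hw
      have : Subgroup.normalClosure S ≤ (q.comp α).ker := by
        apply Subgroup.normalClosure_le_normal
        intro s hs
        have : α s ∈ Subgroup.normalClosure Z :=
          Subgroup.subset_normalClosure (Or.inl ⟨s, hs, rfl⟩)
        exact (QuotientGroup.eq_one_iff _).2 this
      rw [hS] at this
      exact this hw
    have htop : (⊤ : Subgroup P) ≤ ((q.comp α).range).comap q := by
      rw [← hY, Subgroup.closure_le]
      intro y hy
      refine ⟨b y, ?_⟩
      have : y * (α (b y))⁻¹ ∈ Subgroup.normalClosure Z :=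
          Subgroup.subset_normalClosure (Or.inr ⟨y, hy, rfl⟩)
      have := (QuotientGroup.eq_one_iff _).2 this
      have h2 : q (y * (α (b y))⁻¹) = 1 := this
      rw [map_mul, map_inv, mul_inv_eq_one] at h2
      exact h2.symm
    obtain ⟨w, hw⟩ := htop (Subgroup.mem_top p)
    have hw' : q (α w) = q p := hw
    have h1 : p⁻¹ * α w ∈ Subgroup.normalClosure Z := QuotientGroup.eq.1 hw'.symm
    have h2 : g (p⁻¹ * α w) = 1 := by
      have : Subgroup.normalClosure Z ≤ g.ker := by
        apply Subgroup.normalClosure_le_normal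
        rintro _ (⟨s, hs, rfl⟩ | ⟨y, _, rfl⟩)
        · show g (α s) = 1
          rw [hα]
          have : s ∈ φ.ker := by rw [← hS]; exact Subgroup.subset_normalClosure hs
          exact this
        · show g _ = 1
          rw [map_mul, map_inv, hα, hb, mul_inv_cancel]
      exact this h1
    have hp' : g p = 1 := hp
    rw [map_mul, map_inv, hp', hα] at h2
    have h3 : w ∈ φ.ker := by simpa using h2
    have h4 := hαS w h3
    rw [hw'] at h4
    exact (QuotientGroup.eq_one_iff _).1 h4

end Ker
end FibreProd

namespace FibreProd

section Transfer
open scoped commutatorElement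
variable {Γ Γ' J : Type*} [Group Γ] [Group Γ']

lemma ev_map (φ : Γ →* Γ') (e : J → Γ) (L : List J) : ev (φ ∘ e) L = φ (ev e L) := by
  simp [ev, map_list_prod]

lemma Sb_map (φ : Γ →* Γ') (e : J → Γ) (wt : J → ℕ) (Z : Set Γ) (n : ℕ) :
    (Sb e wt Z n).map φ = Sb (φ ∘ e) wt (φ '' Z) n := by
  rw [Sb, MonoidHom.map_closure, Sb]
  congr 1
  ext g
  constructor
  · rintro ⟨_, ⟨L, hL, z, hz, rfl⟩, rfl⟩
    exact ⟨L, hL, φ z, ⟨z, hz, rfl⟩, by simp [ev_map]⟩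
  · rintro ⟨L, hL, _, ⟨z, hz, rfl⟩, rfl⟩
    exact ⟨_, ⟨L, hL, z, hz, rfl⟩, by simp [ev_map]⟩

/-- normal closure of a finite set of elements of a subgroup. -/
def Wn {F : Type*} [Group F] {D : Subgroup F} (s : Finset D) : Subgroup F :=
  Subgroup.normalClosure ((fun x : D => (x : F)) '' (s : Set D))

instance {F : Type*} [Group F] {D : Subgroup F} (s : Finset D) : (Wn s).Normal := by
  unfold Wn; infer_instance

variable {F H : Type*} [Group F] [Group H] (f : F →* H)

/-- the quotient map. -/
def mkW {D : Subgroup F} (s : Finset D) : F →* F ⧸ Wn s := QuotientGroup.mk' (Wn s)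

lemma mkW_surj {D : Subgroup F} (s : Finset D) : Function.Surjective (mkW s) :=
  QuotientGroup.mk'_surjective _

open Filter

lemma ev_eq {z w : F} (h : f z = f w) : ∀ᶠ s : Finset f.ker in atTop, mkW s z = mkW s w := by
  have hd : z⁻¹ * w ∈ f.ker := by rw [MonoidHom.mem_ker]; simp [h]
  filter_upwards [eventually_ge_atTop ({⟨z⁻¹ * w, hd⟩} : Finset f.ker)] with s hs
  apply QuotientGroup.eq.2
  apply Subgroup.subset_normalClosure
  exact ⟨⟨z⁻¹ * w, hd⟩, by simpa using hs, rfl⟩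

lemma ev_mem {z : F} {P : Subgroup F} (h : f z ∈ P.map f) :
    ∀ᶠ s : Finset f.ker in atTop, mkW s z ∈ P.map (mkW s) := by
  obtain ⟨a, ha, hz⟩ := h
  filter_upwards [ev_eq f hz] with s hs
  exact ⟨a, ha, hs⟩

lemma ev_prod {z w : F} {P Q : Subgroup F} (h : ∃ ξ ∈ P.map f, ∃ η ∈ Q.map f,
      f z = f w * (ξ * η)) :
    ∀ᶠ s : Finset f.ker in atTop, ∃ ξ ∈ P.map (mkW s), ∃ η ∈ Q.map (mkW s),
      mkW s z = mkW s w * (ξ * η) := by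
  obtain ⟨_, ⟨a, ha, rfl⟩, _, ⟨b, hb, rfl⟩, hz⟩ := h
  have : f z = f (w * (a * b)) := by simpa using hz
  filter_upwards [ev_eq f this] with s hs
  exact ⟨_, ⟨a, ha, rfl⟩, _, ⟨b, hb, rfl⟩, by simpa using hs⟩

lemma ev_data [Finite J] (e : J → F) (wt : J → ℕ) (X Y : Set F) (hX : X.Finite) (hY : Y.Finite)
    (T : Set J) (C C' N : ℕ) (hf : Function.Surjective f)
    (hD : Data (f ∘ e) wt (f '' X) (f '' Y) T C C' N) :
    ∀ᶠ s : Finset f.ker in atTop,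
      Data (mkW s ∘ e) wt (mkW s '' X) (mkW s '' Y) T C C' N := by
  have h1 : ∀ᶠ s : Finset f.ker in atTop, ∀ i j, ∃ ξ ∈ Sb (mkW s ∘ e) wt (mkW s '' X) 0,
      ∃ η ∈ Sb (mkW s ∘ e) wt (mkW s '' Y) 0,
      (mkW s ∘ e) i * (mkW s ∘ e) j = (mkW s ∘ e) j * (mkW s ∘ e) i * (ξ * η) := by
    rw [eventually_all]; intro i
    rw [eventually_all]; intro j
    have := hD.comm i j
    simp only [← Sb_map, Function.comp_apply, ← map_mul f] at this ⊢
    simpa only [map_mul] using ev_prod f this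
  have h2 : ∀ᶠ s : Finset f.ker in atTop, ∀ j, j ∉ T → ∀ x ∈ mkW s '' X,
      ((mkW s ∘ e) j)⁻¹ * x * (mkW s ∘ e) j ∈ Sb (mkW s ∘ e) wt (mkW s '' X) (wt j - 1) := by
    rw [eventually_all]; intro j
    by_cases hj : j ∈ T
    · simp [hj]
    · simp only [Set.forall_mem_image]
      have : ∀ᶠ s : Finset f.ker in atTop, ∀ x ∈ X,
        ((mkW s ∘ e) j)⁻¹ * mkW s x * (mkW s ∘ e) j ∈ Sb (mkW s ∘ e) wt (mkW s '' X) (wt j - 1)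
        := by
        rw [eventually_all_finite hX]
        intro x hx
        have := hD.V j hj (f x) ⟨x, hx, rfl⟩
        simp only [← Sb_map, Function.comp_apply, ← map_inv, ← map_mul] at this ⊢
        exact ev_mem f this
      filter_upwards [this] with s hs _ x hx
      exact hs x hx
  have h3 : ∀ᶠ s : Finset f.ker in atTop, ∀ j, j ∈ T → ∃ ς : F ⧸ Wn s,
      (∀ x ∈ mkW s '' X, ς * x * ς⁻¹ ∈ Sb (mkW s ∘ e) wt (mkW s '' X) C) ∧
      (∀ i ∈ T, ∃ ξ ∈ Sb (mkW s ∘ e) wt (mkW s '' X) C, ∃ η ∈ Sb (mkW s ∘ e) wt (mkW s '' Y) C',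
        ς * (mkW s ∘ e) i * ς⁻¹ = (mkW s ∘ e) i * (ξ * η)) ∧
      (∀ y ∈ mkW s '' Y, (ς * (mkW s ∘ e) j ^ N) * y * (ς * (mkW s ∘ e) j ^ N)⁻¹
        ∈ Sb (mkW s ∘ e) wt (mkW s '' Y) C) ∧
      (∀ i ∈ T, ∃ η ∈ Sb (mkW s ∘ e) wt (mkW s '' Y) C,
        ∃ ξ ∈ Sb (mkW s ∘ e) wt (mkW s '' X) C',
        (ς * (mkW s ∘ e) j ^ N) * (mkW s ∘ e) i * (ς * (mkW s ∘ e) j ^ N)⁻¹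
          = (mkW s ∘ e) i * (η * ξ)) := by
    rw [eventually_all]; intro j
    by_cases hj : j ∈ T
    · obtain ⟨ς', a1, a2, a3, a4⟩ := hD.T j hj
      obtain ⟨ς, rfl⟩ := hf ς'
      simp only [← Sb_map, Function.comp_apply, Set.forall_mem_image, ← map_pow, ← map_mul f,
        ← map_inv f] at a1 a2 a3 a4 ⊢
      have b1 := (eventually_all_finite (l := (atTop : Filter (Finset f.ker))) hX).2
        (fun x hx => ev_mem f (a1 hx))
      have b3 := (eventually_all_finite (l := (atTop : Filter (Finset f.ker))) hY).2
        (fun x hx => ev_mem f (a3 hx))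
      have b2 := (eventually_all_finite (l := (atTop : Filter (Finset f.ker)))
        T.toFinite).2 (fun i hi => ev_prod f (a2 i hi))
      have b4 := (eventually_all_finite (l := (atTop : Filter (Finset f.ker)))
        T.toFinite).2 (fun i hi => ev_prod f (a4 i hi))
      filter_upwards [b1, b2, b3, b4] with s c1 c2 c3 c4 _
      refine ⟨mkW s ς, ?_, ?_, ?_, ?_⟩
      · intro x hx; simpa only [map_mul, map_inv] using c1 x hx
      · intro x hx; simpa only [map_mul, map_inv] using c2 x hx
      · intro x hx; simpa only [map_mul, map_inv] using c3 x hx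
      · intro x hx; simpa only [map_mul, map_inv] using c4 x hx
    · simp [hj]
  filter_upwards [h1, h2, h3] with s k1 k2 k3
  exact ⟨k1, k2, k3⟩

lemma ev_com [Finite J] (e : J → F) (wt : J → ℕ) (hpos : ∀ j, 1 ≤ wt j) (X Y : Set F)
    (hX : X.Finite) (hY : Y.Finite) (K : ℕ) (hD : Com (f ∘ e) wt (f '' X) (f '' Y) K) :
    ∀ᶠ s : Finset f.ker in atTop, Com (mkW s ∘ e) wt (mkW s '' X) (mkW s '' Y) K := by
  have hfin : {L : List J | wgt wt L ≤ K}.Finite := by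
    refine (List.finite_length_le J K).subset ?_
    intro L hL
    have : ∀ L : List J, L.length ≤ wgt wt L := by
      intro L
      induction L with
      | nil => simp
      | cons a L ih => have := hpos a; simp; omega
    exact (this L).trans hL
  have : ∀ᶠ s : Finset f.ker in atTop, ∀ x ∈ X, ∀ y ∈ Y, ∀ L ∈ {L : List J | wgt wt L ≤ K},
      Commute (mkW s x) (ev (mkW s ∘ e) L * mkW s y * (ev (mkW s ∘ e) L)⁻¹) := by
    rw [eventually_all_finite hX]; intro x hx
    rw [eventually_all_finite hY]; intro y hy
    rw [eventually_all_finite hfin]; intro L hL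
    have := hD (f x) ⟨x, hx, rfl⟩ (f y) ⟨y, hy, rfl⟩ L hL
    simp only [ev_map, Commute, SemiconjBy, ← map_inv, ← map_mul] at this ⊢
    exact ev_eq f this
  filter_upwards [this] with s hs
  rintro _ ⟨x, hx, rfl⟩ _ ⟨y, hy, rfl⟩ L hL
  exact hs x hx y hy L hL

/-- In a group generated by `S`, `SbT Y` is normal. -/
lemma SbT_normal {e : J → Γ} {X Y S : Set Γ} {inv : J → J} (hinv : ∀ j, e (inv j) = (e j)⁻¹)
    (hS : Subgroup.closure S = ⊤) (hcom : Com e (fun _ => 0) X Y 0)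
    (h1 : ∀ g ∈ S ∪ S⁻¹, ∀ y ∈ Y, g * y * g⁻¹ ∈ Sb e (fun _ => 0) Y 0)
    (h2 : ∀ g ∈ S ∪ S⁻¹, ∀ i, ∃ ξ ∈ Sb e (fun _ => 0) X 0, ∃ η ∈ Sb e (fun _ => 0) Y 0,
      g * e i * g⁻¹ = e i * (ξ * η)) : (Sb e (fun _ => 0) Y 0).Normal := by
  have w0 : ∀ L : List J, wgt (fun _ => 0) L = 0 := by
    intro L; simp [wgt]
  have key : ∀ g ∈ S ∪ S⁻¹, ∀ n ∈ Sb e (fun _ => 0) Y 0, g * n * g⁻¹ ∈ Sb e (fun _ => 0) Y 0 := by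
    intro g hg n hn
    have hle : Sb e (fun _ => 0) Y 0 ≤
        (Sb e (fun _ => 0) Y 0).comap (MulAut.conj g).toMonoidHom := by
      conv_lhs => rw [Sb]
      rw [Subgroup.closure_le]
      rintro _ ⟨L, _, y, hy, rfl⟩
      show g * (ev e L * y * (ev e L)⁻¹) * g⁻¹ ∈ Sb e (fun _ => 0) Y 0
      induction L with
      | nil => simpa using h1 g hg y hy
      | cons i L ih =>
        obtain ⟨ξ, hξ, η, hη, hge⟩ := h2 g hg i
        set z := g * (ev e L * y * (ev e L)⁻¹) * g⁻¹ with hz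
        have e1 : g * (ev e (i :: L) * y * (ev e (i :: L))⁻¹) * g⁻¹ =
            (g * e i * g⁻¹) * z * (g * e i * g⁻¹)⁻¹ := by
          rw [hz, ev_cons]; group
        have ih' := ih (by rw [w0])
        have hz' : η * z * η⁻¹ ∈ Sb e (fun _ => 0) Y 0 :=
          Subgroup.mul_mem _ (Subgroup.mul_mem _ hη ih') (Subgroup.inv_mem _ hη)
        have hc := hcom.commute hinv (fun _ => rfl) (le_refl 0) hξ hz'
        have e2 : e i * (ξ * η) * z * (e i * (ξ * η))⁻¹ =
            e i * ((ξ * (η * z * η⁻¹)) * ξ⁻¹) * (e i)⁻¹ := by group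
        rw [e1, hge, e2, hc.eq, mul_inv_cancel_right]
        have := conj_mem_Sb (e := e) (wt := fun _ => 0) (n := 0) [i] hz' (by simp)
        simpa using this
    exact hle hn
  constructor
  intro n hn g
  have hg : g ∈ Subgroup.closure S := by rw [hS]; trivial
  have : (∀ n ∈ Sb e (fun _ => 0) Y 0, g * n * g⁻¹ ∈ Sb e (fun _ => 0) Y 0) ∧
      (∀ n ∈ Sb e (fun _ => 0) Y 0, g⁻¹ * n * g ∈ Sb e (fun _ => 0) Y 0) := by
    induction hg using Subgroup.closure_induction with
    | mem g hg =>
      refine ⟨key g (Or.inl hg), fun n hn => ?_⟩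
      simpa using key g⁻¹ (Or.inr (by simpa using hg)) n hn
    | one => simp
    | mul a b _ _ ha hb =>
      refine ⟨fun n hn => ?_, fun n hn => ?_⟩
      · have := ha.1 _ (hb.1 n hn); simpa [mul_assoc] using this
      · have := hb.2 _ (ha.2 n hn); simpa [mul_assoc] using this
    | inv a _ ha => exact ⟨by simpa using ha.2, by simpa using ha.1⟩
  exact this.1 n hn

lemma Sb_le_normalClosure {e : J → Γ} {wt : J → ℕ} {Z : Set Γ} {n : ℕ} :
    Sb e wt Z n ≤ Subgroup.normalClosure Z := by
  rw [Sb, Subgroup.closure_le]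
  rintro _ ⟨L, _, z, hz, rfl⟩
  exact Subgroup.normalClosure_normal.conj_mem _ (Subgroup.subset_normalClosure hz) _

/-- Abstract criterion for finite presentability. -/
theorem abstract_fp {H G₁ G₂ J : Type*} [Group H] [Group G₁] [Group G₂] [Fintype J]
    [hH : Group.FG H] [Group.IsFinitelyPresented G₁] [Group.IsFinitelyPresented G₂]
    (π₁ : H →* G₁) (π₂ : H →* G₂) (hπ₁ : Function.Surjective π₁) (hπ₂ : Function.Surjective π₂)
    (hinf : π₁.ker ⊓ π₂.ker = ⊥) (hsup : commutator H ≤ π₁.ker ⊔ π₂.ker)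
    (e : J → H) (wt : J → ℕ) (X Y : Set H) (hX : X.Finite) (hY : Y.Finite)
    (hXk : Sb e (fun _ => 0) X 0 = π₂.ker) (hYk : Sb e (fun _ => 0) Y 0 = π₁.ker)
    (T : Set J) (C C' N : ℕ) (inv : J → J) (hinv : ∀ j, e (inv j) = (e j)⁻¹)
    (hinvw : ∀ j, wt (inv j) = wt j) (hpos : ∀ j, 1 ≤ wt j) (hT1 : ∀ j ∈ T, wt j = 1)
    (hTinv : ∀ j ∈ T, inv j ∈ T) (hN : 2 * C + 1 ≤ N) (hD : Data e wt X Y T C C' N) :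
    Group.IsFinitelyPresented H := by
  obtain ⟨α, hαfin, f, hf⟩ := Group.fg_iff_exists_freeGroup_hom_surjective_finite.1 hH
  refine Group.IsFinitelyPresented.of_surjective f hf ?_
  -- lifts
  obtain ⟨σ, hσ⟩ := hf.hasRightInverse
  have hcanc : ∀ Z : Set H, f '' (σ '' Z) = Z := by
    intro Z; rw [Set.image_image]; simp [hσ _]
  let e' : J → FreeGroup α := fun j => σ (e j)
  have he' : f ∘ e' = e := by funext j; exact hσ _
  let X' := σ '' X
  let Y' := σ '' Y
  have hX' : f '' X' = X := hcanc X
  have hY' : f '' Y' = Y := hcanc Y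
  have hXf : X'.Finite := hX.image _
  have hYf : Y'.Finite := hY.image _
  let R₁ := (π₁.comp f).ker
  let R₂ := (π₂.comp f).ker
  have hR₁ : R₁.IsFinitelyNormallyGenerated := ker_fng _ (hπ₁.comp hf)
  have hR₂ : R₂.IsFinitelyNormallyGenerated := ker_fng _ (hπ₂.comp hf)
  have hRR : R₁ ⊓ R₂ = f.ker := by
    show π₁.ker.comap f ⊓ π₂.ker.comap f = f.ker
    rw [← Subgroup.comap_inf, hinf]; rfl
  have hE : commutator (FreeGroup α) ≤ R₁ ⊔ R₂ := by
    show _ ≤ π₁.ker.comap f ⊔ π₂.ker.comap f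
    rw [Subgroup.comap_sup_eq _ _ _ hf, ← Subgroup.map_le_iff_le_comap]
    refine le_trans ?_ hsup
    rw [commutator_def, Subgroup.map_commutator]
    exact Subgroup.commutator_mono le_top le_top
  -- commuting in H
  have hXsub : ∀ x ∈ X, x ∈ π₂.ker := fun x hx => by rw [← hXk]; exact mem_Sb_self hx
  have hYsub : ∀ x ∈ Y, x ∈ π₁.ker := fun x hx => by rw [← hYk]; exact mem_Sb_self hx
  have hComH : ∀ K, Com e wt X Y K := by
    intro K x hx y hy L _
    have h1 := hXsub x hx
    have h2 : ev e L * y * (ev e L)⁻¹ ∈ π₁.ker :=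
      (inferInstance : π₁.ker.Normal).conj_mem _ (hYsub y hy) _
    exact Subgroup.commute_of_normal_of_disjoint _ _ inferInstance inferInstance
      (disjoint_iff.2 (by rw [inf_comm]; exact hinf)) _ _ h1 h2
  set K₀ := 2 * (C + C') + 4 + Fintype.card J * N with hK₀
  have E1 := ev_data f e' wt X' Y' hXf hYf T C C' N hf (by rw [he', hX', hY']; exact hD)
  have E2 := ev_com f e' wt hpos X' Y' hXf hYf K₀ (by rw [he', hX', hY']; exact hComH _)
  have E3 : ∀ᶠ s : Finset f.ker in atTop, ∀ j, mkW s (e' (inv j)) = (mkW s (e' j))⁻¹ := by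
    rw [eventually_all]; intro j
    simp only [← map_inv]
    apply ev_eq
    simp only [map_inv]
    have h := fun j => congrFun he' j
    simp only [Function.comp_apply] at h
    rw [h, h, hinv]
  have hnX : π₂.ker = (Subgroup.normalClosure X').map f := by
    rw [Subgroup.map_normalClosure _ _ hf, hX']
    refine le_antisymm ?_ (Subgroup.normalClosure_le_normal hXsub)
    rw [← hXk]; exact Sb_le_normalClosure
  have hnY : π₁.ker = (Subgroup.normalClosure Y').map f := by
    rw [Subgroup.map_normalClosure _ _ hf, hY']
    refine le_antisymm ?_ (Subgroup.normalClosure_le_normal hYsub)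
    rw [← hYk]; exact Sb_le_normalClosure
  obtain ⟨Z₁, hZ₁f, hZ₁⟩ := id hR₁
  obtain ⟨Z₂, hZ₂f, hZ₂⟩ := id hR₂
  have E4 : ∀ᶠ s : Finset f.ker in atTop, ∀ z ∈ Z₂,
      mkW s z ∈ (Subgroup.normalClosure X').map (mkW s) := by
    rw [eventually_all_finite hZ₂f]
    intro z hz
    apply ev_mem
    rw [← hnX]
    have : z ∈ R₂ := by rw [← hZ₂]; exact Subgroup.subset_normalClosure hz
    exact this
  have E5 : ∀ᶠ s : Finset f.ker in atTop, ∀ z ∈ Z₁,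
      mkW s z ∈ (Subgroup.normalClosure Y').map (mkW s) := by
    rw [eventually_all_finite hZ₁f]
    intro z hz
    apply ev_mem
    rw [← hnY]
    have : z ∈ R₁ := by rw [← hZ₁]; exact Subgroup.subset_normalClosure hz
    exact this
  obtain ⟨S, hS⟩ := (inferInstance : Group.FG (FreeGroup α)).out
  let S' : Set (FreeGroup α) := (S : Set (FreeGroup α)) ∪ (S : Set (FreeGroup α))⁻¹
  have hS'f : S'.Finite := S.finite_toSet.union S.finite_toSet.inv
  have hSbY : (Sb e' (fun _ => 0) Y' 0).map f = π₁.ker := by rw [Sb_map, he', hY', hYk]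
  have hSbX : (Sb e' (fun _ => 0) X' 0).map f = π₂.ker := by rw [Sb_map, he', hX', hXk]
  have E6 : ∀ᶠ s : Finset f.ker in atTop, ∀ g ∈ S', ∀ y ∈ Y',
      mkW s (g * y * g⁻¹) ∈ (Sb e' (fun _ => 0) Y' 0).map (mkW s) := by
    rw [eventually_all_finite hS'f]; intro g _
    rw [eventually_all_finite hYf]; intro y hy
    apply ev_mem
    rw [hSbY]
    have : f y ∈ π₁.ker := hYsub _ (by rw [← hY']; exact ⟨y, hy, rfl⟩)
    have := (inferInstance : π₁.ker.Normal).conj_mem _ this (f g)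
    simpa using this
  have E7 : ∀ᶠ s : Finset f.ker in atTop, ∀ g ∈ S', ∀ i,
      ∃ ξ ∈ (Sb e' (fun _ => 0) X' 0).map (mkW s), ∃ η ∈ (Sb e' (fun _ => 0) Y' 0).map (mkW s),
      mkW s (g * e' i * g⁻¹) = mkW s (e' i) * (ξ * η) := by
    rw [eventually_all_finite hS'f]; intro g _
    rw [eventually_all]; intro i
    apply ev_prod
    rw [hSbY, hSbX]
    have hc : (f (e' i))⁻¹ * f g * ((f (e' i))⁻¹)⁻¹ * (f g)⁻¹ ∈ π₂.ker ⊔ π₁.ker := by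
      rw [sup_comm]; apply hsup
      exact Subgroup.commutator_mem_commutator (Subgroup.mem_top _) (Subgroup.mem_top _)
    obtain ⟨ξ, hξ, η, hη, h⟩ := Subgroup.mem_sup_of_normal_right.1 hc
    refine ⟨ξ, hξ, η, hη, ?_⟩
    rw [h]; simp only [map_mul, map_inv]; group
  obtain ⟨s, c1, c2, c3, c4, c5, c6, c7⟩ :=
    (E1.and (E2.and (E3.and (E4.and (E5.and (E6.and E7)))))).exists
  -- now in the quotient
  let q := mkW s
  have hq : Function.Surjective q := mkW_surj s
  have hall : ∀ K, Com (q ∘ e') wt (q '' X') (q '' Y') K :=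
    com_all (inv := inv) c3 hinvw hpos hT1 hTinv hN c1 K₀ le_rfl c2
  have hcom0 : Com (q ∘ e') (fun _ => 0) (q '' X') (q '' Y') 0 :=
    fun x hx y hy L _ => hall (wgt wt L) x hx y hy L le_rfl
  have hnorm : (Sb (q ∘ e') (fun _ => 0) (q '' Y') 0).Normal := by
    apply SbT_normal (S := q '' (S : Set (FreeGroup α))) (X := q '' X') c3 ?_ hcom0
    · intro g hg y hy
      obtain ⟨y, hy, rfl⟩ := hy
      have : ∃ g' ∈ S', q g' = g := by
        rcases hg with ⟨g', hg', rfl⟩ | hg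
        · exact ⟨g', Or.inl hg', rfl⟩
        · obtain ⟨g', hg', h⟩ := hg
          exact ⟨g'⁻¹, Or.inr (by simpa using hg'), by rw [map_inv, h, inv_inv]⟩
      obtain ⟨g, hg2, rfl⟩ := this
      have := c6 g hg2 y hy
      rw [Sb_map] at this
      simpa only [map_mul, map_inv] using this
    · intro g hg i
      have : ∃ g' ∈ S', q g' = g := by
        rcases hg with ⟨g', hg', rfl⟩ | hg
        · exact ⟨g', Or.inl hg', rfl⟩
        · obtain ⟨g', hg', h⟩ := hg
          exact ⟨g'⁻¹, Or.inr (by simpa using hg'), by rw [map_inv, h, inv_inv]⟩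
      obtain ⟨g, hg2, rfl⟩ := this
      have := c7 g hg2 i
      rw [Sb_map, Sb_map] at this
      simp only [map_mul, map_inv] at this
      exact this
    · rw [← MonoidHom.map_closure, hS, Subgroup.map_top_of_surjective _ hq]
  have hcen : Subgroup.normalClosure (q '' X') ≤
      Subgroup.centralizer (Sb (q ∘ e') (fun _ => 0) (q '' Y') 0 : Set _) := by
    apply Subgroup.normalClosure_le_normal
    intro x hx
    rw [SetLike.mem_coe, Subgroup.mem_centralizer_iff]
    intro y hy
    have := hcom0.commute (inv := inv) c3 (fun _ => rfl) (le_refl 0) (mem_Sb_self hx) hy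
    exact this.eq.symm
  have hny : Subgroup.normalClosure (q '' Y') ≤ Sb (q ∘ e') (fun _ => 0) (q '' Y') 0 :=
    Subgroup.normalClosure_le_normal (fun y hy => mem_Sb_self hy)
  have hR2q : ∀ r ∈ R₂, q r ∈ Subgroup.normalClosure (q '' X') := by
    have : R₂ ≤ (Subgroup.normalClosure (q '' X')).comap q := by
      rw [← hZ₂]
      apply Subgroup.normalClosure_le_normal
      intro z hz
      have := c4 z hz
      rw [Subgroup.map_normalClosure _ _ hq] at this
      exact this
    exact this
  have hR1q : ∀ r ∈ R₁, q r ∈ Subgroup.normalClosure (q '' Y') := by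
    have : R₁ ≤ (Subgroup.normalClosure (q '' Y')).comap q := by
      rw [← hZ₁]
      apply Subgroup.normalClosure_le_normal
      intro z hz
      have := c5 z hz
      rw [Subgroup.map_normalClosure _ _ hq] at this
      exact this
    exact this
  rw [← hRR]
  refine thmA R₁ R₂ (Wn s) hR₁ hR₂ ⟨_, s.finite_toSet.image _, rfl⟩ hE ?_ ?_
  · rw [Subgroup.commutator_le]
    intro a ha b hb
    have := Subgroup.mem_centralizer_iff.1 (hcen (hR2q b hb)) _ (hny (hR1q a ha))
    have h2 : q (⁅a, b⁆) = 1 := by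
      rw [map_commutatorElement, commutatorElement_eq_one_iff_mul_comm]
      exact this
    exact (QuotientGroup.eq_one_iff _).1 h2
  · rw [hRR]
    apply Subgroup.normalClosure_le_normal
    rintro _ ⟨x, _, rfl⟩
    exact x.2

end Transfer
end FibreProd

namespace FibreProd

section Gen

lemma comm_sub_fg {B : Type*} [CommGroup B] [hB : Group.FG B] (L : Subgroup B) : L.FG := by
  have : Module.Finite ℤ (Additive B) := by
    rw [Module.Finite.iff_addGroup_fg]; infer_instance
  have : IsNoetherian ℤ (Additive B) := isNoetherian_of_isNoetherianRing_of_finite _ _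
  rw [Subgroup.fg_iff_add_fg]
  have h := IsNoetherian.noetherian (AddSubgroup.toIntSubmodule (Subgroup.toAddSubgroup L))
  rw [Submodule.fg_iff_addSubgroup_fg] at h
  simpa using h

/-- finitely many elements generate modulo the kernel of a map to an abelian f.g. group -/
lemma exists_gen_mod {G B : Type*} [Group G] [CommGroup B] [Group.FG B] (ψ : G →* B)
    (M : Subgroup G) : ∃ Z : Set G, Z.Finite ∧ Z ⊆ M ∧ M ≤ Subgroup.closure Z ⊔ ψ.ker := by
  obtain ⟨S, hS⟩ := comm_sub_fg (M.map ψ)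
  have hSM : (S : Set B) ⊆ ψ '' M := by
    have : (S : Set B) ⊆ (M.map ψ : Subgroup B) := by rw [← hS]; exact Subgroup.subset_closure
    simpa using this
  obtain ⟨Z, hZM, hZf, hZS⟩ := Set.exists_subset_image_finite_and.1 ⟨_, hSM, S.finite_toSet, rfl⟩
  refine ⟨Z, hZf, hZM, ?_⟩
  rw [← Subgroup.comap_map_eq, MonoidHom.map_closure, ← hZS, hS]
  exact Subgroup.le_comap_map _ _

lemma fg_of_le {G : Type*} [Group G] [Group.FG G] (K M : Subgroup G) [hKn : K.Normal]
    (hc : commutator G ≤ K) (hK : K.FG) (hKM : K ≤ M) : M.FG := by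
  let _ : CommGroup (G ⧸ K) := { (inferInstance : Group (G ⧸ K)) with
    mul_comm := by
      intro a b
      obtain ⟨a, rfl⟩ := QuotientGroup.mk_surjective a
      obtain ⟨b, rfl⟩ := QuotientGroup.mk_surjective b
      apply QuotientGroup.eq.2
      apply hc
      have := Subgroup.commutator_mem_commutator (Subgroup.mem_top b⁻¹) (Subgroup.mem_top a⁻¹)
      rw [commutatorElement_def] at this
      rw [commutator_def]
      simpa [mul_assoc] using this }
  obtain ⟨Z, hZf, hZM, hZ⟩ := exists_gen_mod (QuotientGroup.mk' K) M
  rw [QuotientGroup.ker_mk'] at hZ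
  obtain ⟨S, hS⟩ := hK
  rw [Subgroup.fg_iff]
  refine ⟨Z ∪ S, ?_, hZf.union S.finite_toSet⟩
  rw [Subgroup.closure_union, hS]
  exact le_antisymm (sup_le ((Subgroup.closure_le _).2 hZM) hKM) hZ

/-- letters and their inverses -/
def el {I G : Type*} [Group G] (t : I → G) : I × Bool → G :=
  fun j => if j.2 then t j.1 else (t j.1)⁻¹

lemma el_map {I G G' : Type*} [Group G] [Group G'] (φ : G →* G') (t : I → G) :
    φ ∘ el t = el (φ ∘ t) := by
  funext j
  rcases j with ⟨i, b⟩
  cases b <;> simp [el]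

variable {I : Type*} [Fintype I] [DecidableEq I]

lemma exists_dd {M : Type*} [Group M] (χ : M →* Multiplicative (I → ℤ)) (t : I → M)
    (ht : ∀ i, χ (t i) = Multiplicative.ofAdd (Pi.single i 1)) (m : M) :
    ∃ d ∈ Subgroup.closure (Set.range t), χ d = χ m := by
  refine ⟨(Finset.univ.toList.map (fun i => t i ^ ((χ m).toAdd i))).prod, ?_, ?_⟩
  · apply Subgroup.list_prod_mem
    intro x hx
    obtain ⟨i, _, rfl⟩ := List.mem_map.1 hx
    exact Subgroup.zpow_mem _ (Subgroup.subset_closure (Set.mem_range_self i)) _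
  · rw [map_list_prod, List.map_map, Finset.prod_map_toList]
    apply Multiplicative.toAdd.injective
    funext j
    simp [ht, toAdd_prod, Finset.sum_apply, Pi.single_apply]

lemma gen_letters {M : Type*} [Group M] [hM : Group.FG M] (χ : M →* Multiplicative (I → ℤ))
    (t : I → M) (ht : ∀ i, χ (t i) = Multiplicative.ofAdd (Pi.single i 1)) (X₀ : Set M)
    (hX₀f : X₀.Finite) (hX₀ : X₀ ⊆ χ.ker) :
    ∃ X : Set M, X.Finite ∧ X₀ ⊆ X ∧ X ⊆ χ.ker ∧ Sb (el t) (fun _ => 0) X 0 = χ.ker := by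
  obtain ⟨S, hS⟩ := hM.out
  choose d hd hdχ using exists_dd χ t ht
  let X : Set M := X₀ ∪ (fun s => s * (d s)⁻¹) '' (S : Set M) ∪
    Set.range (fun p : I × I => (t p.2 * t p.1)⁻¹ * (t p.1 * t p.2))
  have hXk : X ⊆ χ.ker := by
    rintro x ((hx | ⟨s, _, rfl⟩) | ⟨p, rfl⟩)
    · exact hX₀ hx
    · show χ _ = 1
      simp [hdχ]
    · show χ _ = 1
      simp only [map_mul, map_inv]
      rw [mul_comm (χ (t p.2)), inv_mul_cancel]
  let P := Sb (el t) (fun _ => 0) X 0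
  have hPk : P ≤ χ.ker := Sb_le_normalClosure.trans (Subgroup.normalClosure_le_normal hXk)
  have hXP : X ⊆ P := fun x hx => mem_Sb_self hx
  have htN : ∀ i, t i ∈ Subgroup.normalizer (P : Set M) := by
    intro i
    rw [Subgroup.mem_normalizer_iff]
    intro h
    constructor
    · intro hh
      have := conj_mem_Sb (e := el t) (wt := fun _ => 0) (n := 0) [(i, true)] hh (by simp)
      simpa [el] using this
    · intro hh
      have := conj_mem_Sb (e := el t) (wt := fun _ => 0) (n := 0) [(i, false)] hh (by simp)
      simpa [el, mul_assoc] using this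
  have hPn : P.Normal := by
    rw [← Subgroup.normalizer_eq_top_iff, eq_top_iff, ← hS, Subgroup.closure_le]
    intro s hs
    have h1 : s * (d s)⁻¹ ∈ Subgroup.normalizer (P : Set M) :=
      Subgroup.le_normalizer (hXP (Or.inl (Or.inr ⟨s, hs, rfl⟩)))
    have h2 : d s ∈ Subgroup.normalizer (P : Set M) := by
      have : Subgroup.closure (Set.range t) ≤ Subgroup.normalizer (P : Set M) := by
        rw [Subgroup.closure_le]; rintro _ ⟨i, rfl⟩; exact htN i
      exact this (hd s)
    have := Subgroup.mul_mem _ h1 h2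
    simpa using this
  let q := QuotientGroup.mk' P
  have hq : Function.Surjective q := QuotientGroup.mk'_surjective _
  have hqs : ∀ s ∈ S, q s = q (d s) := by
    intro s hs
    have : q (s * (d s)⁻¹) = 1 := (QuotientGroup.eq_one_iff _).2
      (hXP (Or.inl (Or.inr ⟨s, hs, rfl⟩)))
    rwa [map_mul, map_inv, mul_inv_eq_one] at this
  have htop : Subgroup.closure (q '' Set.range t) = ⊤ := by
    rw [eq_top_iff, ← Subgroup.map_top_of_surjective _ hq, ← hS, MonoidHom.map_closure,
      Subgroup.closure_le]
    rintro _ ⟨s, hs, rfl⟩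
    rw [hqs s hs, ← MonoidHom.map_closure]
    exact ⟨_, hd s, rfl⟩
  have hcomm : ∀ a b : M ⧸ P, a * b = b * a := by
    intro a b
    have ha : a ∈ Subgroup.closure (q '' Set.range t) := by rw [htop]; trivial
    have hb : b ∈ Subgroup.closure (q '' Set.range t) := by rw [htop]; trivial
    refine (commute_closure ?_ ha hb).eq
    rintro _ ⟨_, ⟨i, rfl⟩, rfl⟩ _ ⟨_, ⟨j, rfl⟩, rfl⟩
    have : q ((t j * t i)⁻¹ * (t i * t j)) = 1 := (QuotientGroup.eq_one_iff _).2
      (hXP (Or.inr ⟨(i, j), rfl⟩))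
    rw [map_mul, map_inv, inv_mul_eq_one, map_mul, map_mul] at this
    exact this.symm
  let _ : CommGroup (M ⧸ P) := { (inferInstance : Group (M ⧸ P)) with mul_comm := hcomm }
  let β : Multiplicative (I → ℤ) →* M ⧸ P := MonoidHom.mk' (fun z => ∏ i, q (t i) ^ (z.toAdd i))
    (by
      intro a b
      simp [zpow_add, Finset.prod_mul_distrib])
  have hβt : ∀ m ∈ Subgroup.closure (Set.range t), β (χ m) = q m := by
    have : Subgroup.closure (Set.range t) ≤ (β.comp χ).eqLocus q := by
      rw [Subgroup.closure_le]
      rintro _ ⟨i, rfl⟩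
      show β (χ (t i)) = q (t i)
      rw [ht]
      show ∏ j, q (t j) ^ ((Pi.single i 1 : I → ℤ) j) = q (t i)
      rw [Finset.prod_eq_single i]
      · simp
      · intro j _ hj; simp [Pi.single_apply, hj]
      · simp
    exact this
  have hβ : ∀ m, β (χ m) = q m := by
    have : (⊤ : Subgroup M) ≤ (β.comp χ).eqLocus q := by
      rw [← hS, Subgroup.closure_le]
      intro s hs
      show β (χ s) = q s
      rw [hqs s hs, ← hdχ, hβt _ (hd s)]
    exact fun m => this (Subgroup.mem_top m)
  refine ⟨X, ?_, fun x hx => Or.inl (Or.inl hx), hXk, le_antisymm hPk ?_⟩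
  · exact (hX₀f.union (S.finite_toSet.image _)).union (Set.finite_range _)
  · intro m hm
    have hm' : χ m = 1 := hm
    have := hβ m
    rw [hm', map_one] at this
    exact (QuotientGroup.eq_one_iff _).1 this.symm

lemma gen_letters' {G : Type*} [Group G] (M : Subgroup G) (hM : M.FG)
    (χ : G →* Multiplicative (I → ℤ))
    (t : I → G) (htM : ∀ i, t i ∈ M)
    (ht : ∀ i, χ (t i) = Multiplicative.ofAdd (Pi.single i 1)) (X₀ : Set G)
    (hX₀f : X₀.Finite) (hX₀ : X₀ ⊆ (M ⊓ χ.ker : Subgroup G)) :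
    ∃ X : Set G, X.Finite ∧ X₀ ⊆ X ∧ X ⊆ (M ⊓ χ.ker : Subgroup G) ∧
      Sb (el t) (fun _ => 0) X 0 = M ⊓ χ.ker := by
  have : Group.FG M := (Group.fg_iff_subgroup_fg M).2 hM
  have hker : (χ.comp M.subtype).ker.map M.subtype = M ⊓ χ.ker := by
    ext x
    constructor
    · rintro ⟨y, hy, rfl⟩; exact ⟨y.2, hy⟩
    · rintro ⟨h1, h2⟩; exact ⟨⟨x, h1⟩, h2, rfl⟩
  obtain ⟨X, hXf, h1, h2, h3⟩ := gen_letters (χ.comp M.subtype) (fun i => ⟨t i, htM i⟩) ht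
    (M.subtype ⁻¹' X₀) (hX₀f.preimage Subtype.val_injective.injOn) (by
      intro x hx
      exact (hX₀ hx).2)
  refine ⟨M.subtype '' X, hXf.image _, ?_, ?_, ?_⟩
  · intro x hx
    exact ⟨⟨x, (hX₀ hx).1⟩, h1 hx, rfl⟩
  · rw [← hker]; rintro _ ⟨x, hx, rfl⟩; exact ⟨x, h2 hx, rfl⟩
  · rw [← hker, ← h3, Sb_map, el_map]; rfl

open Filter in
lemma ev_bound {J G : Type*} [Group G] (e : J → G) (wt : J → ℕ) (Z : Set G) {a : G}
    (ha : a ∈ Sb e (fun _ => 0) Z 0) : ∀ᶠ n in atTop, a ∈ Sb e wt Z n := by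
  rw [Sb] at ha
  induction ha using Subgroup.closure_induction with
  | mem x hx =>
    obtain ⟨L, _, z, hz, rfl⟩ := hx
    filter_upwards [eventually_ge_atTop (wgt wt L)] with n hn
    exact mem_Sb hz hn
  | one => simp [Subgroup.one_mem]
  | mul a b _ _ ha hb =>
    filter_upwards [ha, hb] with n h1 h2
    exact Subgroup.mul_mem _ h1 h2
  | inv a _ ha =>
    filter_upwards [ha] with n h1
    exact Subgroup.inv_mem _ h1

lemma Sb_reindex {J J' G : Type*} [Group G] {e : J → G} {e' : J' → G} {wt : J → ℕ} {wt' : J' → ℕ}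
    (ρ : J' → J) (he : ∀ j, e (ρ j) = e' j) (hw : ∀ j, wt (ρ j) = wt' j) (Z : Set G) (n : ℕ) :
    Sb e' wt' Z n ≤ Sb e wt Z n := by
  rw [Sb, Subgroup.closure_le]
  rintro _ ⟨L, hL, z, hz, rfl⟩
  have h1 : ev e (L.map ρ) = ev e' L := by simp [ev, Function.comp_def, he]
  have h2 : wgt wt (L.map ρ) = wgt wt' L := by simp [wgt, Function.comp_def, hw]
  rw [← h1]
  exact mem_Sb hz (by rw [h2]; exact hL)

lemma Sb_lift {H G₁ G₂ J : Type*} [Group H] [Group G₁] [Group G₂] {π₁ : H →* G₁} {π₂ : H →* G₂}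
    (hinf : π₁.ker ⊓ π₂.ker = ⊥) {e : J → H} {wt : J → ℕ} {X : Set H} (hX : X ⊆ π₂.ker) {n : ℕ}
    {h : H} (hh : h ∈ π₂.ker) (h1 : π₁ h ∈ Sb (π₁ ∘ e) wt (π₁ '' X) n) : h ∈ Sb e wt X n := by
  rw [← Sb_map] at h1
  obtain ⟨a, ha, hah⟩ := h1
  have ha2 : a ∈ π₂.ker := (Sb_le_normalClosure.trans (Subgroup.normalClosure_le_normal hX)) ha
  have : a⁻¹ * h ∈ π₁.ker ⊓ π₂.ker := by
    refine ⟨?_, Subgroup.mul_mem _ (Subgroup.inv_mem _ ha2) hh⟩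
    show π₁ _ = 1
    rw [map_mul, map_inv, hah, inv_mul_cancel]
  rw [hinf, Subgroup.mem_bot, inv_mul_eq_one] at this
  rwa [← this]

end Gen
end FibreProd

namespace FibreProd

section Abs2
open scoped commutatorElement
open Filter

lemma Sb_le_of {J G : Type*} [Group G] {e : J → G} {wt : J → ℕ} {Z : Set G} {n : ℕ}
    {P : Subgroup G} (he : ∀ j, e j ∈ P) (hZ : Z ⊆ P) : Sb e wt Z n ≤ P := by
  rw [Sb, Subgroup.closure_le]
  rintro _ ⟨L, _, z, hz, rfl⟩
  have : ev e L ∈ P := by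
    apply Subgroup.list_prod_mem
    intro x hx
    obtain ⟨j, _, rfl⟩ := List.mem_map.1 hx
    exact he j
  exact P.mul_mem (P.mul_mem this (hZ hz)) (P.inv_mem this)

theorem abstract_fp2 {H G₁ G₂ J B : Type*} [Group H] [Group G₁] [Group G₂] [Fintype J]
    [CommGroup B] [Group.FG B]
    [Group.IsFinitelyPresented G₁] [Group.IsFinitelyPresented G₂]
    (π₁ : H →* G₁) (π₂ : H →* G₂) (hπ₁ : Function.Surjective π₁) (hπ₂ : Function.Surjective π₂)
    (hinf : π₁.ker ⊓ π₂.ker = ⊥) (ψ : H →* B) (hψ : ψ.ker ≤ π₁.ker ⊔ π₂.ker)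
    (e : J → H) (wt : J → ℕ) (X Y : Set H) (hXf : X.Finite) (hYf : Y.Finite)
    (hX : X ⊆ π₂.ker) (hY : Y ⊆ π₁.ker)
    (hX1 : ∀ h ∈ π₂.ker, π₁ h ∈ Sb (π₁ ∘ e) (fun _ => 0) (π₁ '' X) 0)
    (hY1 : ∀ h ∈ π₁.ker, π₂ h ∈ Sb (π₂ ∘ e) (fun _ => 0) (π₂ '' Y) 0)
    (T : Set J) (C N : ℕ) (inv : J → J) (hinv : ∀ j, e (inv j) = (e j)⁻¹)
    (hinvw : ∀ j, wt (inv j) = wt j) (hpos : ∀ j, 1 ≤ wt j) (hT1 : ∀ j ∈ T, wt j = 1)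
    (hTinv : ∀ j ∈ T, inv j ∈ T) (hN : 2 * C + 1 ≤ N)
    (cX : ∀ i j, (π₁ (e j) * π₁ (e i))⁻¹ * (π₁ (e i) * π₁ (e j)) ∈ Sb (π₁ ∘ e) wt (π₁ '' X) 0)
    (cY : ∀ i j, (π₂ (e j) * π₂ (e i))⁻¹ * (π₂ (e i) * π₂ (e j)) ∈ Sb (π₂ ∘ e) wt (π₂ '' Y) 0)
    (hV : ∀ j, j ∉ T → ∀ x ∈ X,
      (π₁ (e j))⁻¹ * π₁ x * π₁ (e j) ∈ Sb (π₁ ∘ e) wt (π₁ '' X) (wt j - 1))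
    (hT : ∀ j ∈ T, ∃ s : H, (∀ x ∈ X, π₁ s * π₁ x * (π₁ s)⁻¹ ∈ Sb (π₁ ∘ e) wt (π₁ '' X) C) ∧
      (∀ i ∈ T, (π₁ (e i))⁻¹ * (π₁ s * π₁ (e i) * (π₁ s)⁻¹) ∈ Sb (π₁ ∘ e) wt (π₁ '' X) C) ∧
      (∀ y ∈ Y, π₂ (s * e j ^ N) * π₂ y * (π₂ (s * e j ^ N))⁻¹ ∈ Sb (π₂ ∘ e) wt (π₂ '' Y) C) ∧
      (∀ i ∈ T, (π₂ (e i))⁻¹ * (π₂ (s * e j ^ N) * π₂ (e i) * (π₂ (s * e j ^ N))⁻¹)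
        ∈ Sb (π₂ ∘ e) wt (π₂ '' Y) C)) :
    Group.IsFinitelyPresented H := by
  have hinf' : π₂.ker ⊓ π₁.ker = ⊥ := by rw [inf_comm]; exact hinf
  have hsup : commutator H ≤ π₁.ker ⊔ π₂.ker := by
    refine le_trans ?_ hψ
    rw [commutator_def, Subgroup.commutator_le]
    intro a _ b _
    rw [MonoidHom.mem_ker, map_commutatorElement, commutatorElement_eq_one_iff_mul_comm, mul_comm]
  have hXk : Sb e (fun _ => 0) X 0 = π₂.ker :=
    le_antisymm (Sb_le_normalClosure.trans (Subgroup.normalClosure_le_normal hX))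
      (fun h hh => Sb_lift hinf hX hh (hX1 h hh))
  have hYk : Sb e (fun _ => 0) Y 0 = π₁.ker :=
    le_antisymm (Sb_le_normalClosure.trans (Subgroup.normalClosure_le_normal hY))
      (fun h hh => Sb_lift hinf' hY hh (hY1 h hh))
  have hfg : Group.FG H := by
    obtain ⟨Z, hZf, _, hZ⟩ := exists_gen_mod ψ (⊤ : Subgroup H)
    rw [Group.fg_iff]
    refine ⟨Z ∪ (Set.range e ∪ (X ∪ Y)), ?_,
      hZf.union ((Set.finite_range e).union (hXf.union hYf))⟩
    rw [eq_top_iff]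
    refine hZ.trans (sup_le (Subgroup.closure_mono (fun z hz => Or.inl hz)) ?_)
    have he : ∀ j, e j ∈ Subgroup.closure (Z ∪ (Set.range e ∪ (X ∪ Y))) :=
      fun j => Subgroup.subset_closure (Or.inr (Or.inl ⟨j, rfl⟩))
    refine hψ.trans (sup_le ?_ ?_)
    · rw [← hYk]
      exact Sb_le_of he (fun y hy => Subgroup.subset_closure (Or.inr (Or.inr (Or.inr hy))))
    · rw [← hXk]
      exact Sb_le_of he (fun y hy => Subgroup.subset_closure (Or.inr (Or.inr (Or.inl hy))))
  -- splitting of commutators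
  have hsplit : ∀ g i : H, ∃ ξ ∈ π₂.ker, ∃ η ∈ π₁.ker, g * i * g⁻¹ = i * (ξ * η) := by
    intro g i
    have : i⁻¹ * g * (i⁻¹)⁻¹ * g⁻¹ ∈ π₂.ker ⊔ π₁.ker := by
      rw [sup_comm]; apply hsup
      exact Subgroup.commutator_mem_commutator (Subgroup.mem_top _) (Subgroup.mem_top _)
    obtain ⟨ξ, hξ, η, hη, h⟩ := Subgroup.mem_sup_of_normal_right.1 this
    exact ⟨ξ, hξ, η, hη, by rw [h]; group⟩
  have hfst : ∀ {ξ η i z : H}, η ∈ π₁.ker → z = i * (ξ * η) → π₁ ξ = (π₁ i)⁻¹ * π₁ z := by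
    intro ξ η i z hη hz
    have : π₁ η = 1 := hη
    rw [hz]; simp [this]
  have hsnd : ∀ {ξ η i z : H}, ξ ∈ π₂.ker → z = i * (ξ * η) → π₂ η = (π₂ i)⁻¹ * π₂ z := by
    intro ξ η i z hη hz
    have : π₂ ξ = 1 := hη
    rw [hz]; simp [this]
  choose s hs1 hs2 hs3 hs4 using hT
  choose ξ hξ η hη hg using hsplit
  have hC' : ∃ C', ∀ j : T, ∀ i, η (s j.1 j.2) (e i) ∈ Sb e wt Y C' ∧
      ξ (s j.1 j.2 * e j.1 ^ N) (e i) ∈ Sb e wt X C' := by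
    have : ∀ᶠ C' in atTop, ∀ j : T, ∀ i, η (s j.1 j.2) (e i) ∈ Sb e wt Y C' ∧
      ξ (s j.1 j.2 * e j.1 ^ N) (e i) ∈ Sb e wt X C' := by
      rw [eventually_all]; intro j
      rw [eventually_all]; intro i
      refine (ev_bound e wt Y ?_).and (ev_bound e wt X ?_)
      · rw [hYk]; exact hη _ _
      · rw [hXk]; exact hξ _ _
    exact this.exists
  obtain ⟨C', hC'⟩ := hC'
  have hcomm12 : ∀ a ∈ π₂.ker, ∀ b ∈ π₁.ker, a * b = b * a := by
    intro a ha b hb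
    exact Subgroup.commute_of_normal_of_disjoint _ _ inferInstance inferInstance
      (disjoint_iff.2 hinf') _ _ ha hb
  refine abstract_fp π₁ π₂ hπ₁ hπ₂ hinf hsup e wt X Y hXf hYf hXk hYk T C C' N inv hinv hinvw
    hpos hT1 hTinv hN ⟨?_, ?_, ?_⟩
  · intro i j
    have h0 : (e j * e i)⁻¹ * (e i * e j) ∈ π₂.ker ⊔ π₁.ker := by
      rw [sup_comm]; apply hsup
      have : ⁅(e i)⁻¹, (e j)⁻¹⁆ ∈ commutator H :=
        Subgroup.commutator_mem_commutator (Subgroup.mem_top _) (Subgroup.mem_top _)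
      rw [commutatorElement_def] at this
      simpa [mul_assoc] using this
    obtain ⟨ξ, hξ, η, hη, h⟩ := Subgroup.mem_sup_of_normal_right.1 h0
    have h' : e i * e j = e j * e i * (ξ * η) := by rw [h]; group
    refine ⟨ξ, Sb_lift hinf hX hξ ?_, η, Sb_lift hinf' hY hη ?_, h'⟩
    · rw [hfst hη h']; simpa only [map_mul] using cX i j
    · rw [hsnd hξ h']; simpa only [map_mul] using cY i j
  · intro j hj x hx
    refine Sb_lift hinf hX ?_ (by simpa only [map_mul, map_inv] using hV j hj x hx)
    have := (inferInstance : π₂.ker.Normal).conj_mem x (hX hx) (e j)⁻¹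
    simpa using this
  · intro j hj
    refine ⟨s j hj, ?_, ?_, ?_, ?_⟩
    · intro x hx
      refine Sb_lift hinf hX ?_ (by simpa only [map_mul, map_inv] using hs1 j hj x hx)
      exact (inferInstance : π₂.ker.Normal).conj_mem x (hX hx) _
    · intro i hi
      refine ⟨ξ (s j hj) (e i), Sb_lift hinf hX (hξ _ _) ?_, η (s j hj) (e i),
        (hC' ⟨j, hj⟩ i).1, hg _ _⟩
      rw [hfst (hη _ _) (hg _ _)]
      simpa only [map_mul, map_inv] using hs2 j hj i hi
    · intro y hy
      refine Sb_lift hinf' hY ?_ (by rw [map_mul, map_mul, map_inv]; exact hs3 j hj y hy)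
      exact (inferInstance : π₁.ker.Normal).conj_mem y (hY hy) _
    · intro i hi
      refine ⟨η (s j hj * e j ^ N) (e i), Sb_lift hinf' hY (hη _ _) ?_,
        ξ (s j hj * e j ^ N) (e i), (hC' ⟨j, hj⟩ i).2, ?_⟩
      · rw [hsnd (hξ _ _) (hg _ _), map_mul, map_mul, map_inv]
        exact hs4 j hj i hi
      · rw [hg, hcomm12 _ (hξ _ _) _ (hη _ _)]

end Abs2
end FibreProd

namespace FibreProd

section Core
open Filter

lemma fg_mulPi (ι : Type*) [Finite ι] : Group.FG (Multiplicative (ι → ℤ)) := by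
  have : AddGroup.FG (ι → ℤ) := by
    rw [← Module.Finite.iff_addGroup_fg]; infer_instance
  infer_instance

lemma fg_prod' {A B : Type*} [CommGroup A] [CommGroup B] [Group.FG A] [Group.FG B] :
    Group.FG (A × B) := by
  infer_instance

variable {ι κ : Type*} [Fintype ι] [DecidableEq ι] [Fintype κ] [DecidableEq κ]

/-- basis vector -/
def bv (i : ι) : Multiplicative (ι → ℤ) := Multiplicative.ofAdd (Pi.single i 1)

lemma commutator_mem_ker {G A : Type*} [Group G] [CommGroup A] (φ : G →* A) (a b : G) :
    (b * a)⁻¹ * (a * b) ∈ φ.ker := by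
  rw [MonoidHom.mem_ker]; simp only [map_mul, map_inv]
  rw [mul_comm (φ b), inv_mul_cancel]

lemma conj_mem_ker {G A : Type*} [Group G] [CommGroup A] (φ : G →* A) (a b : G) :
    b⁻¹ * (a * b * a⁻¹) ∈ φ.ker := by
  rw [MonoidHom.mem_ker]; simp only [map_mul, map_inv]
  rw [mul_comm (φ a)]; simp

/-- the combined hom -/
def sumHom {G : Type*} [Group G] (u' : G →* Multiplicative (ι → ℤ))
    (u'' : G →* Multiplicative (κ → ℤ)) : G →* Multiplicative (ι ⊕ κ → ℤ) :=
  MonoidHom.mk' (fun g => Multiplicative.ofAdd (Sum.elim (u' g).toAdd (u'' g).toAdd)) (by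
    intro a b
    apply Multiplicative.toAdd.injective
    funext k
    cases k <;> simp)

lemma sumHom_ker {G : Type*} [Group G] (u' : G →* Multiplicative (ι → ℤ))
    (u'' : G →* Multiplicative (κ → ℤ)) : (sumHom u' u'').ker = u'.ker ⊓ u''.ker := by
  ext g
  simp only [MonoidHom.mem_ker, Subgroup.mem_inf]
  constructor
  · intro h
    have h' : (Sum.elim (u' g).toAdd (u'' g).toAdd : ι ⊕ κ → ℤ) = 0 := h
    constructor
    · apply Multiplicative.toAdd.injective
      funext i; exact congrFun h' (Sum.inl i)
    · apply Multiplicative.toAdd.injective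
      funext i; exact congrFun h' (Sum.inr i)
  · rintro ⟨h1, h2⟩
    apply Multiplicative.toAdd.injective
    funext k
    show (Sum.elim (u' g).toAdd (u'' g).toAdd : ι ⊕ κ → ℤ) k = 0
    rw [h1, h2]
    cases k <;> simp

theorem core_aux {G₁ G₂ B : Type*} [Group G₁] [Group G₂] [CommGroup B] [Group.FG B]
    [Group.IsFinitelyPresented G₁] [Group.IsFinitelyPresented G₂]
    (φ₁ : G₁ →* B) (φ₂ : G₂ →* B)
    (hφ₁ : Function.Surjective φ₁) (hφ₂ : Function.Surjective φ₂)
    (τ₁ : ι ⊕ κ → G₁) (τ₂ : ι ⊕ κ → G₂) (hτ : ∀ k, φ₁ (τ₁ k) = φ₂ (τ₂ k))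
    (s₁ : ι → G₁) (s₂ : ι → G₂) (C C₁ N : ℕ) (hN : 2 * C + 1 ≤ N)
    (hs : ∀ i b, φ₁ (el s₁ (i, !b)) = φ₂ (el s₂ (i, b) * (el τ₂ (Sum.inl i, b) ^ N)⁻¹))
    (X : Set G₁) (Y : Set G₂) (hXf : X.Finite) (hYf : Y.Finite)
    (hXN : X ⊆ φ₁.ker) (hYN : Y ⊆ φ₂.ker)
    (hX₀ : ∀ i j, (el τ₁ j * el τ₁ i)⁻¹ * (el τ₁ i * el τ₁ j) ∈ X)
    (hY₀ : ∀ i j, (el τ₂ j * el τ₂ i)⁻¹ * (el τ₂ i * el τ₂ j) ∈ Y)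
    (hXgen' : φ₁.ker ≤ Sb (el τ₁) (fun _ => 0) X 0)
    (hYgen' : φ₂.ker ≤ Sb (el τ₂) (fun _ => 0) Y 0)
    (wt : (ι ⊕ κ) × Bool → ℕ) (hwt : wt = fun j => Sum.elim (fun _ => 1) (fun _ => C₁ + 1) j.1)
    (hV : ∀ j b, ∀ x ∈ X, (el τ₁ (Sum.inr j, b))⁻¹ * x * el τ₁ (Sum.inr j, b) ∈
      Sb (el τ₁) wt X C₁)
    (hCa : ∀ a : ι × Bool, ∀ x ∈ X, el s₁ a * x * (el s₁ a)⁻¹ ∈ Sb (el τ₁) wt X C)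
    (hCb : ∀ a : ι × Bool, ∀ j,
      (el τ₁ j)⁻¹ * (el s₁ a * el τ₁ j * (el s₁ a)⁻¹) ∈ Sb (el τ₁) wt X C)
    (hCc : ∀ a : ι × Bool, ∀ y ∈ Y, el s₂ a * y * (el s₂ a)⁻¹ ∈ Sb (el τ₂) wt Y C)
    (hCd : ∀ a : ι × Bool, ∀ j,
      (el τ₂ j)⁻¹ * (el s₂ a * el τ₂ j * (el s₂ a)⁻¹) ∈ Sb (el τ₂) wt Y C) :
    Group.IsFinitelyPresented
        ((φ₁.comp (MonoidHom.fst G₁ G₂)).eqLocus (φ₂.comp (MonoidHom.snd G₁ G₂))) := by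
  let T : Set ((ι ⊕ κ) × Bool) := {j | j.1.isLeft}
  let H := (φ₁.comp (MonoidHom.fst G₁ G₂)).eqLocus (φ₂.comp (MonoidHom.snd G₁ G₂))
  change Group.IsFinitelyPresented H
  have hHmem : ∀ {g : G₁ × G₂}, g ∈ H ↔ φ₁ g.1 = φ₂ g.2 := Iff.rfl
  let π₁ : H →* G₁ := (MonoidHom.fst G₁ G₂).comp H.subtype
  let π₂ : H →* G₂ := (MonoidHom.snd G₁ G₂).comp H.subtype
  have hπ₁ : Function.Surjective π₁ := by
    intro g
    obtain ⟨g', hg'⟩ := hφ₂ (φ₁ g)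
    exact ⟨⟨(g, g'), hg'.symm⟩, rfl⟩
  have hπ₂ : Function.Surjective π₂ := by
    intro g
    obtain ⟨g', hg'⟩ := hφ₁ (φ₂ g)
    exact ⟨⟨(g', g), hg'⟩, rfl⟩
  have hinf : π₁.ker ⊓ π₂.ker = ⊥ := by
    rw [eq_bot_iff]
    rintro h ⟨h1, h2⟩
    exact Subtype.ext (Prod.ext h1 h2)
  have hk2 : ∀ h ∈ π₂.ker, π₁ h ∈ φ₁.ker := by
    intro h hh
    have : h.1.2 = 1 := hh
    have h2 := hHmem.1 h.2
    rw [this, map_one] at h2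
    exact h2
  have hk1 : ∀ h ∈ π₁.ker, π₂ h ∈ φ₂.ker := by
    intro h hh
    have : h.1.1 = 1 := hh
    have h2 := hHmem.1 h.2
    rw [this, map_one] at h2
    exact h2.symm
  let τ : ι ⊕ κ → H := fun k => ⟨(τ₁ k, τ₂ k), hτ k⟩
  have hπ₁e : π₁ ∘ el τ = el τ₁ := el_map π₁ τ
  have hπ₂e : π₂ ∘ el τ = el τ₂ := el_map π₂ τ
  have hπ₁e' : ∀ j, π₁ (el τ j) = el τ₁ j := fun j => congrFun hπ₁e j
  have hπ₂e' : ∀ j, π₂ (el τ j) = el τ₂ j := fun j => congrFun hπ₂e j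
  let X' : Set H := {h | h.1.1 ∈ X ∧ h.1.2 = 1}
  let Y' : Set H := {h | h.1.2 ∈ Y ∧ h.1.1 = 1}
  have hX'im : π₁ '' X' = X := by
    ext x
    constructor
    · rintro ⟨h, hh, rfl⟩; exact hh.1
    · intro hx
      refine ⟨⟨(x, 1), ?_⟩, ⟨hx, rfl⟩, rfl⟩
      rw [hHmem]
      have : x ∈ φ₁.ker := hXN hx
      rw [map_one]; exact this
  have hY'im : π₂ '' Y' = Y := by
    ext x
    constructor
    · rintro ⟨h, hh, rfl⟩; exact hh.1
    · intro hx
      refine ⟨⟨(1, x), ?_⟩, ⟨hx, rfl⟩, rfl⟩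
      rw [hHmem]
      have : x ∈ φ₂.ker := hYN hx
      rw [map_one]; exact this.symm
  have hX'f : X'.Finite := by
    refine Set.Finite.of_finite_image (f := π₁) (by rw [hX'im]; exact hXf) ?_
    intro a ha b hb h
    exact Subtype.ext (Prod.ext h (ha.2.trans hb.2.symm))
  have hY'f : Y'.Finite := by
    refine Set.Finite.of_finite_image (f := π₂) (by rw [hY'im]; exact hYf) ?_
    intro a ha b hb h
    exact Subtype.ext (Prod.ext (ha.2.trans hb.2.symm) h)
  refine abstract_fp2 π₁ π₂ hπ₁ hπ₂ hinf (φ₁.comp π₁) ?_ (el τ) wt X' Y' hX'f hY'f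
    (fun h hh => hh.2) (fun h hh => hh.2) ?_ ?_ T C N (fun j => (j.1, !j.2)) ?_ ?_ ?_ ?_ ?_ hN
    ?_ ?_ ?_ ?_
  · intro h hh
    have h1 : φ₁ h.1.1 = 1 := hh
    have h2 : φ₂ h.1.2 = 1 := (hHmem.1 h.2).symm.trans h1
    let a : H := ⟨(1, h.1.2), by rw [hHmem]; simp [h2]⟩
    let b : H := ⟨(h.1.1, 1), by rw [hHmem]; simp [h1]⟩
    have hab : h = a * b := Subtype.ext (Prod.ext (by simp [a, b]) (by simp [a, b]))
    rw [hab]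
    exact Subgroup.mul_mem_sup (show π₁ a = 1 from rfl) (show π₂ b = 1 from rfl)
  · intro h hh
    rw [hπ₁e, hX'im]
    exact hXgen' (hk2 h hh)
  · intro h hh
    rw [hπ₂e, hY'im]
    exact hYgen' (hk1 h hh)
  · rintro ⟨k, b⟩
    cases b <;> simp [el]
  · intro j; simp [hwt]
  · rintro ⟨i | j, b⟩ <;> simp [hwt]
  · rintro ⟨i | j, b⟩ h
    · simp [hwt]
    · simp [T] at h
  · rintro ⟨i | j, b⟩ h
    · simp [T]
    · simp [T] at h
  · intro i j
    rw [hπ₁e, hX'im, hπ₁e', hπ₁e']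
    exact mem_Sb_self (hX₀ i j)
  · intro i j
    rw [hπ₂e, hY'im, hπ₂e', hπ₂e']
    exact mem_Sb_self (hY₀ i j)
  · rintro ⟨i | j, b⟩ h x hx
    · simp [T] at h
    · rw [hπ₁e, hX'im, hπ₁e']
      have := hV j b (π₁ x) hx.1
      simpa [hwt] using this
  · rintro ⟨i | j, b⟩ h
    · have hς : (el s₁ (i, !b), el s₂ (i, b) * (el τ₂ (Sum.inl i, b) ^ N)⁻¹) ∈ H := hs i b
      refine ⟨⟨_, hς⟩, ?_, ?_, ?_, ?_⟩
      · intro x hx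
        rw [hπ₁e, hX'im]
        exact hCa (i, !b) (π₁ x) hx.1
      · intro k _
        rw [hπ₁e, hX'im, hπ₁e']
        exact hCb (i, !b) k
      all_goals
        have hσ : π₂ (⟨_, hς⟩ * el τ (Sum.inl i, b) ^ N) = el s₂ (i, b) := by
          rw [map_mul, map_pow, hπ₂e']
          show el s₂ (i, b) * (el τ₂ (Sum.inl i, b) ^ N)⁻¹ * (el τ₂ (Sum.inl i, b)) ^ N = _
          rw [inv_mul_cancel_right]
        rw [hπ₂e, hY'im, hσ]
      · intro y hy
        exact hCc (i, b) (π₂ y) hy.1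
      · intro k _
        rw [hπ₂e']
        exact hCd (i, b) k
    · simp [T] at h

set_option maxHeartbeats 400000 in
theorem core {G₁ G₂ : Type*} [Group G₁] [Group G₂] [Group.IsFinitelyPresented G₁]
    [Group.IsFinitelyPresented G₂]
    (p' : G₁ →* Multiplicative (ι → ℤ)) (p'' : G₁ →* Multiplicative (κ → ℤ))
    (r : G₁ →* Multiplicative (ι → ℤ))
    (hsurj₁ : ∀ a b c, ∃ g, p' g = a ∧ p'' g = b ∧ r g = c)
    (u' : G₂ →* Multiplicative (ι → ℤ)) (u'' : G₂ →* Multiplicative (κ → ℤ))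
    (w : G₂ →* Multiplicative (ι → ℤ))
    (hsurj₂ : ∀ a b c, ∃ g, u' g = a ∧ u'' g = b ∧ w g = c)
    (hM₁ : (p'.ker ⊓ p''.ker).FG) (hM₂ : w.ker.FG) :
    ∃ (φ₁ : G₁ →* Multiplicative (ι → ℤ) × Multiplicative (κ → ℤ) × Multiplicative (ι → ℤ))
      (φ₂ : G₂ →* Multiplicative (ι → ℤ) × Multiplicative (κ → ℤ) × Multiplicative (ι → ℤ)),
      Function.Surjective φ₁ ∧ Function.Surjective φ₂ ∧
      Group.IsFinitelyPresented
        ((φ₁.comp (MonoidHom.fst G₁ G₂)).eqLocus (φ₂.comp (MonoidHom.snd G₁ G₂))) := by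
  choose t₁ ht₁ ht₁' ht₁'' using fun i => hsurj₁ 1 1 (bv i)
  choose v₁ hv₁ hv₁' hv₁'' using fun j => hsurj₁ 1 (bv j) 1
  choose s₁ hs₁ hs₁' hs₁'' using fun i => hsurj₁ (bv i) 1 1
  choose t₂ ht₂ ht₂' ht₂'' using fun i => hsurj₂ (bv i) 1 1
  choose v₂ hv₂ hv₂' hv₂'' using fun j => hsurj₂ 1 (bv j) 1
  choose s₂ hs₂ hs₂' hs₂'' using fun i => hsurj₂ 1 1 (bv i)
  let τ₁ : ι ⊕ κ → G₁ := Sum.elim t₁ v₁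
  let τ₂ : ι ⊕ κ → G₂ := Sum.elim t₂ v₂
  let N₁ : Subgroup G₁ := (p'.ker ⊓ p''.ker) ⊓ r.ker
  let N₂ : Subgroup G₂ := w.ker ⊓ (sumHom u' u'').ker
  have hN₁n : N₁.Normal := inferInstance
  have hN₂n : N₂.Normal := inferInstance
  -- side one
  obtain ⟨X, hXf, hX₀, hXN, hXgen⟩ := gen_letters' (p'.ker ⊓ p''.ker) hM₁ r t₁
    (fun i => ⟨ht₁ i, ht₁' i⟩) ht₁''
    (Set.range (fun p : ((ι ⊕ κ) × Bool) × ((ι ⊕ κ) × Bool) =>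
      (el τ₁ p.2 * el τ₁ p.1)⁻¹ * (el τ₁ p.1 * el τ₁ p.2)))
    (Set.finite_range _) (by
      rintro _ ⟨p, rfl⟩
      exact ⟨⟨commutator_mem_ker _ _ _, commutator_mem_ker _ _ _⟩, commutator_mem_ker _ _ _⟩)
  change X ⊆ N₁ at hXN
  change _ = N₁ at hXgen
  obtain ⟨Y, hYf, hY₀, hYN, hYgen⟩ := gen_letters' w.ker hM₂ (sumHom u' u'') τ₂
    (by rintro (i | j); exacts [ht₂'' i, hv₂'' j])
    (by
      rintro (i | j)
      · apply Multiplicative.toAdd.injective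
        show (Sum.elim (u' (t₂ i)).toAdd (u'' (t₂ i)).toAdd : ι ⊕ κ → ℤ) = _
        rw [ht₂, ht₂']
        funext k
        cases k <;> simp [bv, Pi.single_apply]
      · apply Multiplicative.toAdd.injective
        show (Sum.elim (u' (v₂ j)).toAdd (u'' (v₂ j)).toAdd : ι ⊕ κ → ℤ) = _
        rw [hv₂, hv₂']
        funext k
        cases k <;> simp [bv, Pi.single_apply])
    (Set.range (fun p : ((ι ⊕ κ) × Bool) × ((ι ⊕ κ) × Bool) =>
      (el τ₂ p.2 * el τ₂ p.1)⁻¹ * (el τ₂ p.1 * el τ₂ p.2)))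
    (Set.finite_range _) (by
      rintro _ ⟨p, rfl⟩
      exact ⟨commutator_mem_ker _ _ _, commutator_mem_ker _ _ _⟩)
  change Y ⊆ N₂ at hYN
  change _ = N₂ at hYgen
  -- weight
  obtain ⟨C₁, hC₁⟩ : ∃ C₁, ∀ j : κ × Bool, ∀ x ∈ X,
      (el v₁ j)⁻¹ * x * el v₁ j ∈ Sb (el t₁) (fun _ => 1) X C₁ := by
    have : ∀ᶠ C₁ in atTop, ∀ j : κ × Bool, ∀ x ∈ X,
        (el v₁ j)⁻¹ * x * el v₁ j ∈ Sb (el t₁) (fun _ => 1) X C₁ := by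
      rw [eventually_all]; intro j
      rw [eventually_all_finite hXf]; intro x hx
      apply ev_bound
      rw [hXgen]
      have := hN₁n.conj_mem x (hXN hx) (el v₁ j)⁻¹
      simpa using this
    exact this.exists
  let wt : (ι ⊕ κ) × Bool → ℕ := fun j => Sum.elim (fun _ => 1) (fun _ => C₁ + 1) j.1
  have hel : ∀ j : ι × Bool, el τ₁ (Sum.inl j.1, j.2) = el t₁ j := by
    rintro ⟨i, b⟩; cases b <;> simp [el, τ₁]
  have hwt1 : ∀ j : ι × Bool, wt (Sum.inl j.1, j.2) = 1 := by
    rintro ⟨i, b⟩; simp [wt]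
  have hre : ∀ (Z : Set G₁) (n : ℕ), Sb (el t₁) (fun _ => 1) Z n ≤ Sb (el τ₁) wt Z n := by
    intro Z n
    exact Sb_reindex (fun j : ι × Bool => ((Sum.inl j.1, j.2) : (ι ⊕ κ) × Bool)) hel hwt1 Z n
  have hXgen' : N₁ ≤ Sb (el τ₁) (fun _ => 0) X 0 := by
    refine hXgen.ge.trans ?_
    exact Sb_reindex (e := el τ₁) (e' := el t₁) (wt := fun _ => 0) (wt' := fun _ => 0)
      (fun j : ι × Bool => ((Sum.inl j.1, j.2) : (ι ⊕ κ) × Bool)) hel (fun _ => rfl) X 0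
  obtain ⟨C, hCa, hCb, hCc, hCd⟩ : ∃ C, (∀ a : ι × Bool, ∀ x ∈ X,
      el s₁ a * x * (el s₁ a)⁻¹ ∈ Sb (el τ₁) wt X C) ∧
      (∀ a : ι × Bool, ∀ j,
      (el τ₁ j)⁻¹ * (el s₁ a * el τ₁ j * (el s₁ a)⁻¹) ∈ Sb (el τ₁) wt X C) ∧
      (∀ a : ι × Bool, ∀ y ∈ Y, el s₂ a * y * (el s₂ a)⁻¹ ∈ Sb (el τ₂) wt Y C) ∧
      (∀ a : ι × Bool, ∀ j,
      (el τ₂ j)⁻¹ * (el s₂ a * el τ₂ j * (el s₂ a)⁻¹) ∈ Sb (el τ₂) wt Y C) := by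
    have e1 : ∀ᶠ C in atTop, ∀ a : ι × Bool, ∀ x ∈ X,
        el s₁ a * x * (el s₁ a)⁻¹ ∈ Sb (el τ₁) wt X C := by
      rw [eventually_all]; intro a
      rw [eventually_all_finite hXf]; intro x hx
      apply ev_bound; apply hXgen'
      exact hN₁n.conj_mem x (hXN hx) _
    have e2 : ∀ᶠ C in atTop, ∀ a : ι × Bool, ∀ j,
        (el τ₁ j)⁻¹ * (el s₁ a * el τ₁ j * (el s₁ a)⁻¹) ∈ Sb (el τ₁) wt X C := by
      rw [eventually_all]; intro a
      rw [eventually_all]; intro j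
      apply ev_bound; apply hXgen'
      exact ⟨⟨conj_mem_ker _ _ _, conj_mem_ker _ _ _⟩, conj_mem_ker _ _ _⟩
    have e3 : ∀ᶠ C in atTop, ∀ a : ι × Bool, ∀ y ∈ Y,
        el s₂ a * y * (el s₂ a)⁻¹ ∈ Sb (el τ₂) wt Y C := by
      rw [eventually_all]; intro a
      rw [eventually_all_finite hYf]; intro x hx
      apply ev_bound; rw [hYgen]
      exact hN₂n.conj_mem x (hYN hx) _
    have e4 : ∀ᶠ C in atTop, ∀ a : ι × Bool, ∀ j,
        (el τ₂ j)⁻¹ * (el s₂ a * el τ₂ j * (el s₂ a)⁻¹) ∈ Sb (el τ₂) wt Y C := by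
      rw [eventually_all]; intro a
      rw [eventually_all]; intro j
      apply ev_bound; rw [hYgen]
      exact ⟨conj_mem_ker _ _ _, conj_mem_ker _ _ _⟩
    exact (e1.and (e2.and (e3.and e4))).exists
  let N := 2 * C + 1
  let φ₁ : G₁ →* Multiplicative (ι → ℤ) × Multiplicative (κ → ℤ) × Multiplicative (ι → ℤ) :=
    p'.prod (p''.prod r)
  let φ₂ : G₂ →* Multiplicative (ι → ℤ) × Multiplicative (κ → ℤ) × Multiplicative (ι → ℤ) :=
    (w⁻¹).prod (u''.prod (u' * w ^ N))
  have hφ₁ : Function.Surjective φ₁ := by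
    rintro ⟨a, b, c⟩
    obtain ⟨g, h1, h2, h3⟩ := hsurj₁ a b c
    exact ⟨g, by simp [φ₁, h1, h2, h3]⟩
  have hφ₂ : Function.Surjective φ₂ := by
    rintro ⟨a, b, c⟩
    obtain ⟨g, h1, h2, h3⟩ := hsurj₂ (c * a ^ N) b a⁻¹
    exact ⟨g, by simp [φ₂, h1, h2, h3]⟩
  have hφ₁k : φ₁.ker = N₁ := by
    ext g
    simp only [φ₁, N₁, MonoidHom.mem_ker, Subgroup.mem_inf, MonoidHom.prod_apply, Prod.mk_eq_one]
    tauto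
  have hφ₂k : φ₂.ker = N₂ := by
    ext g
    simp only [φ₂, N₂, sumHom_ker, MonoidHom.mem_ker, Subgroup.mem_inf, MonoidHom.prod_apply,
      Prod.mk_eq_one, MonoidHom.inv_apply, inv_eq_one, MonoidHom.mul_apply, MonoidHom.pow_apply]
    constructor
    · rintro ⟨h1, h2, h3⟩; simp only [h1, one_pow, mul_one] at h3; exact ⟨h1, h3, h2⟩
    · rintro ⟨h1, h3, h2⟩; simp only [h1, one_pow, mul_one]; exact ⟨trivial, h2, h3⟩
  have hfgι := fg_mulPi ι
  have hfgκ := fg_mulPi κ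
  have hτ : ∀ k, φ₁ (τ₁ k) = φ₂ (τ₂ k) := by
    rintro (i | j)
    · simp [τ₁, τ₂, φ₁, φ₂, ht₁, ht₁', ht₁'', ht₂, ht₂', ht₂'']
    · simp [τ₁, τ₂, φ₁, φ₂, hv₁, hv₁', hv₁'', hv₂, hv₂', hv₂'']
  have hs : ∀ i b, φ₁ (el s₁ (i, !b)) = φ₂ (el s₂ (i, b) * (el τ₂ (Sum.inl i, b) ^ N)⁻¹) := by
    intro i b
    cases b <;> simp [el, τ₂, φ₁, φ₂, hs₁, hs₁', hs₁'', hs₂, hs₂', hs₂'', ht₂, ht₂', ht₂'']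
  refine ⟨φ₁, φ₂, hφ₁, hφ₂, ?_⟩
  refine core_aux φ₁ φ₂ hφ₁ hφ₂ τ₁ τ₂ hτ s₁ s₂ C C₁ N le_rfl hs X Y hXf hYf
    (by rw [hφ₁k]; exact hXN) (by rw [hφ₂k]; exact hYN)
    (fun i j => hX₀ ⟨(i, j), rfl⟩) (fun i j => hY₀ ⟨(i, j), rfl⟩)
    (by rw [hφ₁k]; exact hXgen') (by rw [hφ₂k, hYgen]) wt rfl
    (fun j b x hx => hre _ _ (hC₁ (j, b) x hx)) hCa hCb hCc hCd

end Core
end FibreProd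

namespace FibreProd
section Final

lemma fp_iff {G : Type*} [Group G] :
    FinitelyPresentedGroup G ↔ Group.IsFinitelyPresented G := by
  constructor
  · rintro ⟨n, f, S, hf, hS⟩
    exact ⟨n, f, hf, S, S.finite_toSet, hS.symm⟩
  · rintro ⟨n, f, hf, S, hSf, hS⟩
    exact ⟨n, f, hSf.toFinset, hf, by simpa using hS.symm⟩

lemma fg_of_fp {G : Type*} [Group G] (h : FinitelyPresentedGroup G) : Group.FG G := by
  obtain ⟨n, f, S, hf, hS⟩ := h
  exact Group.fg_of_surjective hf

lemma free_quot (Q : Type*) [AddCommGroup Q] [Module.Finite ℤ Q] :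
    ∃ e : Q →ₗ[ℤ] (Fin (Module.finrank ℤ Q) → ℤ), Function.Surjective e := by
  have h : Module.finrank ℤ (Q ⧸ Submodule.torsion ℤ Q) = Module.finrank ℤ Q := by
    unfold Module.finrank
    rw [rank_quotient_eq_of_le_torsion le_rfl]
  let b := Module.finBasisOfFinrankEq ℤ (Q ⧸ Submodule.torsion ℤ Q) h
  exact ⟨b.equivFun.toLinearMap ∘ₗ (Submodule.torsion ℤ Q).mkQ,
    b.equivFun.surjective.comp (Submodule.mkQ_surjective _)⟩

lemma ab_split {A Q : Type*} [AddCommGroup A] [AddCommGroup Q] [Module.Finite ℤ A]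
    (f : A →ₗ[ℤ] Q) (hf : Function.Surjective f) :
    ∃ (s : ℕ) (P : A →ₗ[ℤ] (Fin (Module.finrank ℤ Q) → ℤ)) (R : A →ₗ[ℤ] (Fin s → ℤ)),
      Module.finrank ℤ Q + s = Module.finrank ℤ A ∧ LinearMap.ker f ≤ LinearMap.ker P ∧
      ∀ a b, ∃ x, P x = a ∧ R x = b := by
  have : Module.Finite ℤ Q := Module.Finite.of_surjective f hf
  obtain ⟨e, he⟩ := free_quot Q
  let P := e ∘ₗ f
  have hP : Function.Surjective P := he.comp hf
  obtain ⟨σ, hσ⟩ := Module.projective_lifting_property P LinearMap.id hP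
  have hσ' : ∀ y, P (σ y) = y := fun y => LinearMap.congr_fun hσ y
  obtain ⟨R₀, hR₀⟩ := free_quot (LinearMap.ker P)
  let d : A →ₗ[ℤ] LinearMap.ker P := (LinearMap.id - σ ∘ₗ P).codRestrict (LinearMap.ker P) (by
    intro x; simp [hσ'])
  refine ⟨_, P, R₀ ∘ₗ d, ?_, ?_, ?_⟩
  · have h1 := Submodule.finrank_quotient_add_finrank (LinearMap.ker P)
    rw [(P.quotKerEquivOfSurjective hP).finrank_eq] at h1
    simpa using h1
  · exact LinearMap.ker_le_ker_comp f e
  · intro a b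
    obtain ⟨y, hy⟩ := hR₀ b
    have hPy : P y = 0 := y.2
    have hPx : P (σ a + y) = a := by rw [map_add, hσ', hPy, add_zero]
    refine ⟨σ a + y, hPx, ?_⟩
    rw [LinearMap.comp_apply, ← hy]
    congr 1
    apply Subtype.ext
    simp [d, hσ', hPy]

lemma grp_split {G : Type*} [Group G] [Group.FG G] (K : Subgroup G) (hK : K.Normal) :
    ∃ (s : ℕ) (P : G →* Multiplicative (Fin (rkQuot K hK) → ℤ))
      (R : G →* Multiplicative (Fin s → ℤ)),
      rkQuot K hK + s = rkAb G ∧ K ≤ P.ker ∧ ∀ a b, ∃ x, P x = a ∧ R x = b := by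
  have : Group.FG (Abelianization G) :=
    Group.fg_of_surjective (f := Abelianization.of) (QuotientGroup.mk_surjective)
  have : Module.Finite ℤ (Additive (Abelianization G)) := by
    rw [Module.Finite.iff_addGroup_fg]; infer_instance
  let f : Additive (Abelianization G) →ₗ[ℤ] Additive (Abelianization (G ⧸ K)) :=
    (MonoidHom.toAdditive (Abelianization.map (QuotientGroup.mk' K))).toIntLinearMap
  have hfa : ∀ g : G, f (Additive.ofMul (Abelianization.of g)) =
      Additive.ofMul (Abelianization.of (QuotientGroup.mk' K g)) := fun g => rfl
  have hf : Function.Surjective f := by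
    intro y
    obtain ⟨y', hy'⟩ := QuotientGroup.mk_surjective (Additive.toMul y)
    obtain ⟨g, rfl⟩ := QuotientGroup.mk_surjective y'
    exact ⟨Additive.ofMul (Abelianization.of g), hy'⟩
  obtain ⟨s, P, R, h1, h2, h3⟩ := ab_split f hf
  refine ⟨s, (AddMonoidHom.toMultiplicativeRight P.toAddMonoidHom).comp Abelianization.of,
    (AddMonoidHom.toMultiplicativeRight R.toAddMonoidHom).comp Abelianization.of, h1, ?_, ?_⟩
  · intro g hg
    have : Additive.ofMul (Abelianization.of g) ∈ LinearMap.ker f := by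
      rw [LinearMap.mem_ker, hfa]
      have : QuotientGroup.mk' K g = 1 := (QuotientGroup.eq_one_iff g).2 hg
      rw [this, map_one]; rfl
    exact h2 this
  · intro a b
    obtain ⟨x, hx1, hx2⟩ := h3 a.toAdd b.toAdd
    obtain ⟨g, hg⟩ := QuotientGroup.mk_surjective (Additive.toMul x)
    refine ⟨g, ?_, ?_⟩
    · have : P (Additive.ofMul (Abelianization.of g)) = a.toAdd := by
        rw [← hx1]; exact congrArg P hg
      exact this
    · have : R (Additive.ofMul (Abelianization.of g)) = b.toAdd := by
        rw [← hx2]; exact congrArg R hg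
      exact this

/-- pull back coordinates -/
def reindexHom {α β : Type*} (ρ : α → β) : Multiplicative (β → ℤ) →* Multiplicative (α → ℤ) :=
  MonoidHom.mk' (fun v => Multiplicative.ofAdd (fun a => v.toAdd (ρ a))) (fun _ _ => rfl)

lemma grp_split' {G : Type*} [Group G] [Group.FG G] (K : Subgroup G) (hK : K.Normal)
    {α β : Type*} [Fintype α] [Fintype β]
    (h1 : Fintype.card α ≤ rkQuot K hK)
    (h2 : Fintype.card α + Fintype.card β ≤ rkAb G) :
    ∃ (P : G →* Multiplicative (α → ℤ)) (R : G →* Multiplicative (β → ℤ)),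
      K ≤ P.ker ∧ ∀ a b, ∃ x, P x = a ∧ R x = b := by
  obtain ⟨s, P, R, hs, hPK, hPR⟩ := grp_split K hK
  let S : G →* Multiplicative (Fin (rkQuot K hK) ⊕ Fin s → ℤ) := sumHom P R
  obtain ⟨ρ, hρ⟩ : ∃ ρ : α → Fin (rkQuot K hK), Function.Injective ρ := by
    obtain ⟨e⟩ := Function.Embedding.nonempty_of_card_le (α := α) (β := Fin (rkQuot K hK))
      (by simpa using h1)
    exact ⟨e, e.injective⟩
  obtain ⟨θ, hθ, hθρ⟩ : ∃ θ : β → Fin (rkQuot K hK) ⊕ Fin s, Function.Injective θ ∧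
      ∀ a b, θ b ≠ Sum.inl (ρ a) := by
    classical
    let U := {x : Fin (rkQuot K hK) ⊕ Fin s // x ∉ Set.range (fun a => (Sum.inl (ρ a) :
      Fin (rkQuot K hK) ⊕ Fin s))}
    have hU : Fintype.card β ≤ Fintype.card U := by
      have := Fintype.card_subtype_compl (fun x : Fin (rkQuot K hK) ⊕ Fin s =>
        x ∈ Set.range (fun a => (Sum.inl (ρ a) : Fin (rkQuot K hK) ⊕ Fin s)))
      have h3 : Fintype.card {x : Fin (rkQuot K hK) ⊕ Fin s //
        x ∈ Set.range (fun a => (Sum.inl (ρ a) : Fin (rkQuot K hK) ⊕ Fin s))} = Fintype.card α :=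
        Set.card_range_of_injective (Sum.inl_injective.comp hρ)
      rw [h3, Fintype.card_sum, Fintype.card_fin, Fintype.card_fin, hs] at this
      change _ ≤ Fintype.card {x : Fin (rkQuot K hK) ⊕ Fin s // ¬
        x ∈ Set.range (fun a => (Sum.inl (ρ a) : Fin (rkQuot K hK) ⊕ Fin s))}
      omega
    obtain ⟨e⟩ := Function.Embedding.nonempty_of_card_le hU
    exact ⟨fun b => (e b).1, Subtype.val_injective.comp e.injective,
      fun a b h => (e b).2 ⟨a, h.symm⟩⟩
  refine ⟨(reindexHom ρ).comp P, (reindexHom θ).comp S, ?_, ?_⟩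
  · intro g hg
    have : P g = 1 := hPK hg
    rw [MonoidHom.mem_ker, MonoidHom.comp_apply, this, map_one]
  · intro a b
    classical
    let z : Fin (rkQuot K hK) ⊕ Fin s → ℤ := fun x =>
      if h : ∃ i, Sum.inl (ρ i) = x then a.toAdd h.choose
      else if h : ∃ j, θ j = x then b.toAdd h.choose else 0
    have hz1 : ∀ i, z (Sum.inl (ρ i)) = a.toAdd i := by
      intro i
      have h : ∃ i', (Sum.inl (ρ i') : Fin (rkQuot K hK) ⊕ Fin s) = Sum.inl (ρ i) := ⟨i, rfl⟩
      have h' : h.choose = i := hρ (Sum.inl_injective h.choose_spec)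
      simp only [z]
      rw [dif_pos h, h']
    have hz2 : ∀ j, z (θ j) = b.toAdd j := by
      intro j
      have h0 : ¬ ∃ i', Sum.inl (ρ i') = θ j := fun ⟨i, hi⟩ => hθρ i j hi.symm
      have h : ∃ i', θ i' = θ j := ⟨j, rfl⟩
      have h' : h.choose = j := hθ h.choose_spec
      simp only [z]
      rw [dif_neg h0, dif_pos h, h']
    obtain ⟨x, hx1, hx2⟩ := hPR (Multiplicative.ofAdd fun i => z (Sum.inl i))
      (Multiplicative.ofAdd fun i => z (Sum.inr i))
    have hS : (S x).toAdd = z := by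
      show (Sum.elim (P x).toAdd (R x).toAdd : _ → ℤ) = z
      rw [hx1, hx2]
      funext k
      cases k <;> simp
    refine ⟨x, ?_, ?_⟩
    · apply Multiplicative.toAdd.injective
      funext i
      rw [← hz1 i]
      show (P x).toAdd (ρ i) = _
      rw [hx1]; simp
    · apply Multiplicative.toAdd.injective
      funext j
      rw [← hz2 j, ← hS]; rfl

lemma split_sum {G α β : Type*} [Group G] (P : G →* Multiplicative (α ⊕ β → ℤ)) (a : Multiplicative (α → ℤ))
    (b : Multiplicative (β → ℤ)) {x : G}
    (h : P x = Multiplicative.ofAdd (Sum.elim a.toAdd b.toAdd)) :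
    (reindexHom Sum.inl).comp P x = a ∧ (reindexHom Sum.inr).comp P x = b := by
  constructor
  · rw [MonoidHom.comp_apply, h]; rfl
  · rw [MonoidHom.comp_apply, h]; rfl

lemma rk_of_surj {G B : Type*} [Group G] [CommGroup B] (f : G →* B) (hf : Function.Surjective f)
    (h : f.ker.Normal) : rkQuot f.ker h = Module.finrank ℤ (Additive B) := by
  have e := QuotientGroup.quotientKerEquivOfSurjective f hf
  have e2 : Abelianization (G ⧸ f.ker) ≃* B := e.abelianizationCongr.trans
    (Abelianization.equivOfComm (H := B)).symm
  exact (MulEquiv.toAdditive e2).toIntLinearEquiv.finrank_eq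

lemma finrank_B (b c : ℕ) : Module.finrank ℤ (Additive (Multiplicative (Fin b → ℤ) ×
    Multiplicative (Fin c → ℤ) × Multiplicative (Fin b → ℤ))) = b + c + b := by
  let e : Additive (Multiplicative (Fin b → ℤ) ×
    Multiplicative (Fin c → ℤ) × Multiplicative (Fin b → ℤ)) ≃+
      (Fin b → ℤ) × (Fin c → ℤ) × (Fin b → ℤ) :=
    { toFun := fun x => ((Additive.toMul x).1.toAdd, (Additive.toMul x).2.1.toAdd,
        (Additive.toMul x).2.2.toAdd)
      invFun := fun x => Additive.ofMul (Multiplicative.ofAdd x.1, Multiplicative.ofAdd x.2.1,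
        Multiplicative.ofAdd x.2.2)
      left_inv := fun _ => rfl
      right_inv := fun _ => rfl
      map_add' := fun _ _ => rfl }
  rw [e.toIntLinearEquiv.finrank_eq]
  simp [Module.finrank_prod]
  omega

lemma commutator_prod_le {G₁ G₂ B : Type*} [Group G₁] [Group G₂] [CommGroup B]
    (f : G₁ × G₂ →* B) : (commutator G₁).prod (commutator G₂) ≤ f.ker := by
  rintro ⟨a, b⟩ ⟨ha, hb⟩
  have h1 : f (a, 1) = 1 := Abelianization.commutator_subset_ker
    (f.comp (MonoidHom.inl G₁ G₂)) ha
  have h2 : f (1, b) = 1 := Abelianization.commutator_subset_ker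
    (f.comp (MonoidHom.inr G₁ G₂)) hb
  have : ((a, b) : G₁ × G₂) = (a, 1) * (1, b) := by simp
  rw [MonoidHom.mem_ker, this, map_mul, h1, h2, one_mul]

theorem final_le {G₁ G₂ : Type*} [Group G₁] [Group G₂]
    (hfp₁ : FinitelyPresentedGroup G₁) (hfp₂ : FinitelyPresentedGroup G₂)
    (K₁ : Subgroup G₁) (K₂ : Subgroup G₂) (hK₁n : K₁.Normal) (hK₂n : K₂.Normal)
    (hc₁ : commutator G₁ ≤ K₁) (hc₂ : commutator G₂ ≤ K₂)
    (hKfg₁ : K₁.FG) (hKfg₂ : K₂.FG)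
    (m k : ℕ) (hm : rkQuot K₁ hK₁n = m) (hk : rkQuot K₂ hK₂n = k) (hkm : k ≤ m) :
    ∃ (H : Subgroup (G₁ × G₂)) (hHn : H.Normal),
      Subgroup.map (MonoidHom.fst G₁ G₂) H = ⊤ ∧
      Subgroup.map (MonoidHom.snd G₁ G₂) H = ⊤ ∧
      (commutator G₁).prod (commutator G₂) ≤ H ∧
      FinitelyPresentedGroup ↥H ∧
      rkQuot H hHn = min (m + k) (min (rkAb G₁) (rkAb G₂)) := by
  have i₁ := fp_iff.1 hfp₁
  have i₂ := fp_iff.1 hfp₂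
  have f₁ : Group.FG G₁ := fg_of_fp hfp₁
  have f₂ : Group.FG G₂ := fg_of_fp hfp₂
  have hm₁ : m ≤ rkAb G₁ := by
    obtain ⟨s, _, _, h, _⟩ := grp_split K₁ hK₁n
    omega
  have hk₂ : k ≤ rkAb G₂ := by
    obtain ⟨s, _, _, h, _⟩ := grp_split K₂ hK₂n
    omega
  obtain ⟨n, hn⟩ : ∃ n, n = min (m + k) (min (rkAb G₁) (rkAb G₂)) := ⟨_, rfl⟩
  have hn1 : n ≤ m + k := by omega
  have hn2 : n ≤ rkAb G₁ := by omega
  have hn3 : n ≤ rkAb G₂ := by omega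
  obtain ⟨b, c, hbc, hbk, hbcn⟩ : ∃ b c, b + c ≤ m ∧ b ≤ k ∧ b + c + b = n := by
    by_cases h : n ≤ m
    · exact ⟨0, n, by omega, by omega, by omega⟩
    · exact ⟨n - m, 2 * m - n, by omega, by omega, by omega⟩
  obtain ⟨P, r, hPK, hPr⟩ := grp_split' (α := Fin b ⊕ Fin c) (β := Fin b) K₁ hK₁n
    (by simp; omega) (by simp; omega)
  obtain ⟨w, U, hwK, hwU⟩ := grp_split' (α := Fin b) (β := Fin b ⊕ Fin c) K₂ hK₂n
    (by simp; omega) (by simp; omega)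
  obtain ⟨φ₁, φ₂, hφ₁, hφ₂, hfp⟩ := core ((reindexHom Sum.inl).comp P)
    ((reindexHom Sum.inr).comp P) r (by
      intro a b c
      obtain ⟨x, hx, hx'⟩ := hPr (Multiplicative.ofAdd (Sum.elim a.toAdd b.toAdd)) c
      have := split_sum P a b hx
      exact ⟨x, this.1, this.2, hx'⟩)
    ((reindexHom Sum.inl).comp U) ((reindexHom Sum.inr).comp U) w (by
      intro a b c
      obtain ⟨x, hx', hx⟩ := hwU c (Multiplicative.ofAdd (Sum.elim a.toAdd b.toAdd))
      have := split_sum U a b hx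
      exact ⟨x, this.1, this.2, hx'⟩)
    (by
      refine fg_of_le K₁ _ hc₁ hKfg₁ ?_
      intro g hg
      have : P g = 1 := hPK hg
      simp [Subgroup.mem_inf, MonoidHom.mem_ker, this])
    (fg_of_le K₂ _ hc₂ hKfg₂ hwK)
  let f : G₁ × G₂ →* Multiplicative (Fin b → ℤ) × Multiplicative (Fin c → ℤ) ×
      Multiplicative (Fin b → ℤ) :=
    φ₁.comp (MonoidHom.fst G₁ G₂) * (φ₂.comp (MonoidHom.snd G₁ G₂))⁻¹
  have hker : f.ker = (φ₁.comp (MonoidHom.fst G₁ G₂)).eqLocus (φ₂.comp (MonoidHom.snd G₁ G₂)) := by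
    ext g
    rw [MonoidHom.mem_ker]
    show φ₁ g.1 * (φ₂ g.2)⁻¹ = 1 ↔ φ₁ g.1 = φ₂ g.2
    rw [mul_inv_eq_one]
  have hmem : ∀ g, g ∈ f.ker ↔ φ₁ g.1 = φ₂ g.2 := by
    intro g; rw [hker]; rfl
  have hfs : Function.Surjective f := by
    intro y
    obtain ⟨g, hg⟩ := hφ₁ y
    refine ⟨(g, 1), ?_⟩
    show φ₁ g * (φ₂ 1)⁻¹ = y
    rw [hg]; simp
  refine ⟨f.ker, inferInstance, ?_, ?_, commutator_prod_le f, ?_, ?_⟩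
  · rw [eq_top_iff]
    intro g _
    obtain ⟨g', hg'⟩ := hφ₂ (φ₁ g)
    exact ⟨(g, g'), (hmem _).2 hg'.symm, rfl⟩
  · rw [eq_top_iff]
    intro g _
    obtain ⟨g', hg'⟩ := hφ₁ (φ₂ g)
    exact ⟨(g', g), (hmem _).2 hg', rfl⟩
  · rw [fp_iff, hker]; exact hfp
  · rw [rk_of_surj f hfs, finrank_B, hbcn, hn]

lemma rkQuot_comap {G G' : Type*} [Group G] [Group G'] (e : G ≃* G') (H : Subgroup G')
    (hH : H.Normal) (h : (H.comap e.toMonoidHom).Normal) :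
    rkQuot (H.comap e.toMonoidHom) h = rkQuot H hH := by
  have e1 : G ⧸ (H.comap e.toMonoidHom) ≃* G' ⧸ H := QuotientGroup.congr _ _ e (by
    exact Subgroup.map_comap_eq_self_of_surjective e.surjective H)
  exact (MulEquiv.toAdditive e1.abelianizationCongr).toIntLinearEquiv.finrank_eq

end Final
end FibreProd

/-- If `G₁, G₂` are finitely presented with finitely generated subgroups `Gᵢ' ≤ Kᵢ ≤ Gᵢ`
of co-ranks `m` and `k`, then there is a finitely presented normal fibre product in
`G₁ × G₂` of co-rank `min {m + k, rk G₁/G₁', rk G₂/G₂'}`. -/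
theorem exists_fp_normal_fibre_product_of_fg_subgroups {G₁ G₂ : Type*} [Group G₁] [Group G₂]
    (hfp₁ : FinitelyPresentedGroup G₁) (hfp₂ : FinitelyPresentedGroup G₂)
    (K₁ : Subgroup G₁) (K₂ : Subgroup G₂) (hK₁n : K₁.Normal) (hK₂n : K₂.Normal)
    (hc₁ : commutator G₁ ≤ K₁) (hc₂ : commutator G₂ ≤ K₂)
    (hKfg₁ : K₁.FG) (hKfg₂ : K₂.FG)
    (m k : ℕ) (hm : rkQuot K₁ hK₁n = m) (hk : rkQuot K₂ hK₂n = k) :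
    ∃ (H : Subgroup (G₁ × G₂)) (hHn : H.Normal),
      Subgroup.map (MonoidHom.fst G₁ G₂) H = ⊤ ∧
      Subgroup.map (MonoidHom.snd G₁ G₂) H = ⊤ ∧
      (commutator G₁).prod (commutator G₂) ≤ H ∧
      FinitelyPresentedGroup ↥H ∧
      rkQuot H hHn = min (m + k) (min (rkAb G₁) (rkAb G₂)) := by
  rcases le_total k m with h | h
  · exact FibreProd.final_le hfp₁ hfp₂ K₁ K₂ hK₁n hK₂n hc₁ hc₂ hKfg₁ hKfg₂ m k hm hk h
  · obtain ⟨H, hHn, h1, h2, h3, h4, h5⟩ := FibreProd.final_le hfp₂ hfp₁ K₂ K₁ hK₂n hK₁n hc₂ hc₁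
      hKfg₂ hKfg₁ k m hk hm h
    let e : G₁ × G₂ ≃* G₂ × G₁ := MulEquiv.prodComm
    have hn : (H.comap e.toMonoidHom).Normal := hHn.comap _
    refine ⟨H.comap e.toMonoidHom, hn, ?_, ?_, ?_, ?_, ?_⟩
    · rw [eq_top_iff]
      intro g _
      have hg : g ∈ Subgroup.map (MonoidHom.snd G₂ G₁) H := by rw [h2]; trivial
      obtain ⟨⟨x, y⟩, hx, hxy⟩ := hg
      exact ⟨(y, x), hx, hxy⟩
    · rw [eq_top_iff]
      intro g _
      have hg : g ∈ Subgroup.map (MonoidHom.fst G₂ G₁) H := by rw [h1]; trivial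
      obtain ⟨⟨x, y⟩, hx, hxy⟩ := hg
      exact ⟨(y, x), hx, hxy⟩
    · rintro ⟨a, b⟩ ⟨ha, hb⟩
      exact h3 (show (b, a) ∈ (commutator G₂).prod (commutator G₁) from ⟨hb, ha⟩)
    · rw [FibreProd.fp_iff] at h4 ⊢
      have E : H ≃* H.comap e.toMonoidHom :=
        { toFun := fun x => ⟨e.symm x.1, show e (e.symm x.1) ∈ H by
            rw [MulEquiv.apply_symm_apply]; exact x.2⟩
          invFun := fun x => ⟨e x.1, x.2⟩
          left_inv := fun _ => rfl
          right_inv := fun _ => rfl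
          map_mul' := fun _ _ => rfl }
      exact Group.IsFinitelyPresented.equiv E
    · rw [FibreProd.rkQuot_comap e H hHn hn, h5, add_comm k m, min_comm (rkAb G₂)]
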